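/- arXiv:2307.08522 — 5 statements merged into one kernel-verified Lean document; each statement's English description precedes it below -/
import Mathlib

section
/- Suppose u, v, w : ℝ⁴ → ℝ are C² and P̃ : ℝ⁴ → ℝ is C², satisfying the transformed β-plane system u_t + u u_x + v u_y + w u_z + 2Ω w − β y v = −P̃_x/ρ, v_t + u v_x + v v_y + w v_z + β y u = −P̃_y/ρ, w_t + u w_x + v w_y + w w_z − 2Ω u = −P̃_z/ρ, the mass conservation condition u_x + v_y + w_z = 0, and having constant vorticity, i.e. (w_y − v_z, u_z − w_x, v_x − u_y) = (Λ₁, Λ₂, Λ₃) identically for real constants Λ₁, Λ₂, Λ₃. Then at every point of ℝ⁴: Λ₁ u_x + (Λ₂ + 2Ω) u_y + (Λ₃ + β y) u_z = 0, Λ₁ v_x + (Λ₂ + 2Ω) v_y + (Λ₃ + β y) v_z = 0, and Λ₁ w_x + (Λ₂ + 2Ω) w_y + (Λ₃ + β y) w_z − β v = 0. -/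
/-- Partial derivative in the `x` direction on `ℝ⁴` with coordinates `(x,y,z,t)`. -/
noncomputable def pX (f : ℝ × ℝ × ℝ × ℝ → ℝ) (p : ℝ × ℝ × ℝ × ℝ) : ℝ :=
  fderiv ℝ f p (1, 0, 0, 0)

/-- Partial derivative in the `y` direction. -/
noncomputable def pY (f : ℝ × ℝ × ℝ × ℝ → ℝ) (p : ℝ × ℝ × ℝ × ℝ) : ℝ :=
  fderiv ℝ f p (0, 1, 0, 0)

/-- Partial derivative in the `z` direction. -/
noncomputable def pZ (f : ℝ × ℝ × ℝ × ℝ → ℝ) (p : ℝ × ℝ × ℝ × ℝ) : ℝ :=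
  fderiv ℝ f p (0, 0, 1, 0)

/-- Partial derivative in the `t` direction. -/
noncomputable def pT (f : ℝ × ℝ × ℝ × ℝ → ℝ) (p : ℝ × ℝ × ℝ × ℝ) : ℝ :=
  fderiv ℝ f p (0, 0, 0, 1)

/-- The second derivative of `f` at `p`, along `b` first and then along `a`. -/
noncomputable def secondDeriv (f : ℝ × ℝ × ℝ × ℝ → ℝ) (p a b : ℝ × ℝ × ℝ × ℝ) : ℝ :=
  fderiv ℝ (fderiv ℝ f) p a b

theorem secondDeriv_comm {f : ℝ × ℝ × ℝ × ℝ → ℝ} (hf : ContDiff ℝ 2 f)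
    (p a b : ℝ × ℝ × ℝ × ℝ) : secondDeriv f p a b = secondDeriv f p b a :=
  (hf.contDiffAt.isSymmSndFDerivAt (by simp)).eq a b

theorem hasFDerivAt_fderiv_apply {f : ℝ × ℝ × ℝ × ℝ → ℝ} (hf : ContDiff ℝ 2 f)
    (p b : ℝ × ℝ × ℝ × ℝ) :
    HasFDerivAt (fun q => fderiv ℝ f q b) ((fderiv ℝ (fderiv ℝ f) p).flip b) p := by
  have h : DifferentiableAt ℝ (fderiv ℝ f) p :=
    (hf.fderiv_right (m := 1) (by norm_num)).differentiable (by norm_num) p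
  simpa using h.hasFDerivAt.clm_apply (hasFDerivAt_const b p)

/-- If a difference of two directional derivatives is constant, its derivative vanishes. -/
theorem secondDeriv_eq_of_sub_const {f g : ℝ × ℝ × ℝ × ℝ → ℝ} (hf : ContDiff ℝ 2 f)
    (hg : ContDiff ℝ 2 g) {b c : ℝ × ℝ × ℝ × ℝ} {Λ : ℝ}
    (h : ∀ q, fderiv ℝ f q b - fderiv ℝ g q c = Λ) (p a : ℝ × ℝ × ℝ × ℝ) :
    secondDeriv f p b a = secondDeriv g p c a := by
  have h1 := (hasFDerivAt_fderiv_apply hf p b).sub (hasFDerivAt_fderiv_apply hg p c)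
  have h2 : HasFDerivAt (fun q => fderiv ℝ f q b - fderiv ℝ g q c)
      (0 : ℝ × ℝ × ℝ × ℝ →L[ℝ] ℝ) p := by
    simpa only [h] using hasFDerivAt_const Λ p
  have h3 := congrArg (fun L => L a) (h1.unique h2)
  simp only [sub_apply, ContinuousLinearMap.flip_apply,
    zero_apply] at h3
  rw [secondDeriv_comm hf, secondDeriv_comm hg]
  exact sub_eq_zero.mp h3

/-- A momentum equation with force `c`, differentiated along `a`. -/
theorem momentum_deriv {u v w f c P : ℝ × ℝ × ℝ × ℝ → ℝ} (hu : ContDiff ℝ 2 u)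
    (hv : ContDiff ℝ 2 v) (hw : ContDiff ℝ 2 w) (hf : ContDiff ℝ 2 f) (hP : ContDiff ℝ 2 P)
    {ρ : ℝ} {e p : ℝ × ℝ × ℝ × ℝ} {c' : ℝ × ℝ × ℝ × ℝ →L[ℝ] ℝ} (hc : HasFDerivAt c c' p)
    (h : ∀ q, pT f q + u q * pX f q + v q * pY f q + w q * pZ f q + c q
      = -(fderiv ℝ P q e) / ρ) (a : ℝ × ℝ × ℝ × ℝ) :
    secondDeriv f p a (0, 0, 0, 1) + u p * secondDeriv f p a (1, 0, 0, 0)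
      + v p * secondDeriv f p a (0, 1, 0, 0) + w p * secondDeriv f p a (0, 0, 1, 0)
      + fderiv ℝ u p a * pX f p + fderiv ℝ v p a * pY f p + fderiv ℝ w p a * pZ f p
      + c' a = -(secondDeriv P p a e) / ρ := by
  have hu' := (hu.differentiable (by norm_num) p).hasFDerivAt
  have hv' := (hv.differentiable (by norm_num) p).hasFDerivAt
  have hw' := (hw.differentiable (by norm_num) p).hasFDerivAt
  have hL := ((((hasFDerivAt_fderiv_apply hf p (0, 0, 0, 1)).add
    (hu'.mul (hasFDerivAt_fderiv_apply hf p (1, 0, 0, 0)))).add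
    (hv'.mul (hasFDerivAt_fderiv_apply hf p (0, 1, 0, 0)))).add
    (hw'.mul (hasFDerivAt_fderiv_apply hf p (0, 0, 1, 0)))).add hc
  have hR := (hasFDerivAt_fderiv_apply hP p e).const_mul (-ρ⁻¹)
  have hLR := hL.congr_of_eventuallyEq (Filter.Eventually.of_forall fun q =>
    (show -ρ⁻¹ * fderiv ℝ P q e = _ by rw [neg_mul, inv_mul_eq_div, ← neg_div]; exact (h q).symm))
  have key := congrArg (fun L => L a) (hLR.unique hR)
  simp only [add_apply, smul_apply,
    ContinuousLinearMap.flip_apply, smul_eq_mul] at key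
  simp only [secondDeriv, pX, pY, pZ]
  linear_combination key

/-- A constant-vorticity solution of the transformed β-plane system with mass conservation
satisfies the first-order linear system obtained by eliminating the pressure. -/
theorem transformed_to_linear (Ω β ρ : ℝ) (hρ : 0 < ρ) (Λ₁ Λ₂ Λ₃ : ℝ)
    (u v w Ptil : ℝ × ℝ × ℝ × ℝ → ℝ)
    (hu : ContDiff ℝ 2 u) (hv : ContDiff ℝ 2 v) (hw : ContDiff ℝ 2 w)
    (hPtil : ContDiff ℝ 2 Ptil)
    (heq1 : ∀ p : ℝ × ℝ × ℝ × ℝ,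
      pT u p + u p * pX u p + v p * pY u p + w p * pZ u p + 2 * Ω * w p
        - β * p.2.1 * v p = -(pX Ptil p) / ρ)
    (heq2 : ∀ p : ℝ × ℝ × ℝ × ℝ,
      pT v p + u p * pX v p + v p * pY v p + w p * pZ v p + β * p.2.1 * u p
        = -(pY Ptil p) / ρ)
    (heq3 : ∀ p : ℝ × ℝ × ℝ × ℝ,
      pT w p + u p * pX w p + v p * pY w p + w p * pZ w p - 2 * Ω * u p
        = -(pZ Ptil p) / ρ)
    (hmass : ∀ p : ℝ × ℝ × ℝ × ℝ, pX u p + pY v p + pZ w p = 0)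
    (hvort1 : ∀ p : ℝ × ℝ × ℝ × ℝ, pY w p - pZ v p = Λ₁)
    (hvort2 : ∀ p : ℝ × ℝ × ℝ × ℝ, pZ u p - pX w p = Λ₂)
    (hvort3 : ∀ p : ℝ × ℝ × ℝ × ℝ, pX v p - pY u p = Λ₃) :
    ∀ p : ℝ × ℝ × ℝ × ℝ,
      Λ₁ * pX u p + (Λ₂ + 2 * Ω) * pY u p + (Λ₃ + β * p.2.1) * pZ u p = 0 ∧
      Λ₁ * pX v p + (Λ₂ + 2 * Ω) * pY v p + (Λ₃ + β * p.2.1) * pZ v p = 0 ∧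
      Λ₁ * pX w p + (Λ₂ + 2 * Ω) * pY w p + (Λ₃ + β * p.2.1) * pZ w p - β * v p = 0 := by
  intro p
  have hu' := (hu.differentiable (by norm_num) p).hasFDerivAt
  have hv' := (hv.differentiable (by norm_num) p).hasFDerivAt
  have hw' := (hw.differentiable (by norm_num) p).hasFDerivAt
  have hy : HasFDerivAt (fun q : ℝ × ℝ × ℝ × ℝ => β * q.2.1) _ p :=
    ((ContinuousLinearMap.fst ℝ ℝ (ℝ × ℝ)).comp
      (ContinuousLinearMap.snd ℝ ℝ (ℝ × ℝ × ℝ))).hasFDerivAt.const_mul β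
  have D₁ := momentum_deriv (e := (1, 0, 0, 0)) hu hv hw hu hPtil
    ((hw'.const_mul (2 * Ω)).sub (hy.mul hv'))
    (fun q => by simpa only [pX, Pi.sub_apply, Pi.mul_apply, add_sub_assoc] using heq1 q)
  have D₂ := momentum_deriv (e := (0, 1, 0, 0)) hu hv hw hv hPtil (hy.mul hu') heq2
  have D₃ := momentum_deriv (e := (0, 0, 1, 0)) hu hv hw hw hPtil
    (hu'.const_mul (-(2 * Ω)))
    (fun q => by simpa only [pZ, neg_mul, ← sub_eq_add_neg] using heq3 q)
  simp only [add_apply, sub_apply,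
    smul_apply, ContinuousLinearMap.comp_apply,
    ContinuousLinearMap.coe_fst', ContinuousLinearMap.coe_snd', smul_eq_mul] at D₁ D₂ D₃
  have V₁ := secondDeriv_eq_of_sub_const hw hv hvort1 p
  have V₂ := secondDeriv_eq_of_sub_const hu hw hvort2 p
  have V₃ := secondDeriv_eq_of_sub_const hv hu hvort3 p
  have hm := hmass p
  rw [← hvort1 p, ← hvort2 p, ← hvort3 p]
  have D₃y := D₃ (0, 1, 0, 0)
  have D₂z := D₂ (0, 0, 1, 0)
  have D₁z := D₁ (0, 0, 1, 0)
  have D₃x := D₃ (1, 0, 0, 0)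
  have D₂x := D₂ (1, 0, 0, 0)
  have D₁y := D₁ (0, 1, 0, 0)
  rw [secondDeriv_comm hPtil p (0, 1, 0, 0) (0, 0, 1, 0)] at D₃y
  rw [secondDeriv_comm hPtil p (0, 0, 1, 0) (1, 0, 0, 0)] at D₁z
  rw [secondDeriv_comm hPtil p (1, 0, 0, 0) (0, 1, 0, 0)] at D₂x
  simp only [V₁] at D₃y
  simp only [V₂] at D₁z
  simp only [V₃] at D₂x
  simp only [pX, pY, pZ] at *
  refine ⟨?_, ?_, ?_⟩
  · linear_combination D₂z - D₃y
      + (fderiv ℝ w p (0, 1, 0, 0) - fderiv ℝ v p (0, 0, 1, 0)) * hm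
  · linear_combination D₃x - D₁z
      + (fderiv ℝ u p (0, 0, 1, 0) - fderiv ℝ w p (1, 0, 0, 0) + 2 * Ω) * hm
  · linear_combination D₁y - D₂x
      + (fderiv ℝ v p (1, 0, 0, 0) - fderiv ℝ u p (0, 1, 0, 0) + β * p.2.1) * hm
end

section
/- Let Λ₁, Λ₂, Λ₃, Ω be real constants with Λ₂ + 2Ω ≠ 0, β > 0, and let d be a real constant. Suppose u, v, w : ℝ⁴ → ℝ are C², satisfy at every point the linear system Λ₁ u_x + (Λ₂ + 2Ω) u_y + (Λ₃ + β y) u_z = 0, Λ₁ v_x + (Λ₂ + 2Ω) v_y + (Λ₃ + β y) v_z = 0, Λ₁ w_x + (Λ₂ + 2Ω) w_y + (Λ₃ + β y) w_z − β v = 0, the mass conservation condition u_x + v_y + w_z = 0, the constant-vorticity condition (w_y − v_z, u_z − w_x, v_x − u_y) = (Λ₁, Λ₂, Λ₃), and the flat-bottom boundary condition w(x, y, −d, t) = 0 for all x, y, t. Then the vorticity vanishes, Λ₁ = Λ₂ = Λ₃ = 0, and v ≡ 0, w ≡ 0, while u(x,y,z,t) = a(t) for some function a : ℝ → ℝ.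 -/
/-- The derivative of `f` along the vector field `(A, B, C + β y, 0)`. -/
noncomputable def shearDeriv (A B C β : ℝ) (f : ℝ × ℝ × ℝ × ℝ → ℝ) (p : ℝ × ℝ × ℝ × ℝ) : ℝ :=
  A * pX f p + B * pY f p + (C + β * p.2.1) * pZ f p

lemma shearDeriv_const (A B C β c : ℝ) (p : ℝ × ℝ × ℝ × ℝ) :
    shearDeriv A B C β (fun _ => c) p = 0 := by
  simp [shearDeriv, pX, pY, pZ]

lemma shearDeriv_const_add (A B C β c : ℝ) (f : ℝ × ℝ × ℝ × ℝ → ℝ) (p : ℝ × ℝ × ℝ × ℝ) :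
    shearDeriv A B C β (fun q => c + f q) p = shearDeriv A B C β f p := by
  simp [shearDeriv, pX, pY, pZ]

/-- Directional derivatives commute with `shearDeriv` up to a `z`-derivative coming from the
`y`-dependence of the vector field. -/
lemma shearDeriv_fderiv_apply (A B C β : ℝ) {f g : ℝ × ℝ × ℝ × ℝ → ℝ} (hf : ContDiff ℝ 2 f)
    (h : ∀ p, shearDeriv A B C β f p = g p) (e p : ℝ × ℝ × ℝ × ℝ) :
    shearDeriv A B C β (fun q => fderiv ℝ f q e) p + β * e.2.1 * pZ f p = fderiv ℝ g p e := by
  have hd : DifferentiableAt ℝ (fderiv ℝ f) p :=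
    (hf.fderiv_right (m := 1) (by norm_num)).differentiable (by norm_num) p
  have hsymm : IsSymmSndFDerivAt ℝ f p := hf.contDiffAt.isSymmSndFDerivAt (by simp)
  have hdir : ∀ a : ℝ × ℝ × ℝ × ℝ, HasFDerivAt (fun q => fderiv ℝ f q a)
      ((fderiv ℝ (fderiv ℝ f) p).flip a) p := fun a => by
    simpa using hd.hasFDerivAt.clm_apply (hasFDerivAt_const a p)
  have hy : HasFDerivAt (fun q : ℝ × ℝ × ℝ × ℝ => q.2.1)
      ((ContinuousLinearMap.fst ℝ ℝ (ℝ × ℝ)).comp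
        (ContinuousLinearMap.snd ℝ ℝ (ℝ × ℝ × ℝ))) p :=
    ((ContinuousLinearMap.fst ℝ ℝ (ℝ × ℝ)).comp
      (ContinuousLinearMap.snd ℝ ℝ (ℝ × ℝ × ℝ))).hasFDerivAt
  have hD := (((hdir (1, 0, 0, 0)).const_mul A).add ((hdir (0, 1, 0, 0)).const_mul B)).add
    (((hy.const_mul β).const_add C).mul (hdir (0, 0, 1, 0)))
  have hg : HasFDerivAt g _ p :=
    hD.congr_of_eventuallyEq (Filter.Eventually.of_forall fun q => (h q).symm)
  rw [hg.fderiv]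
  simp only [shearDeriv, pX, pY, pZ, (hdir e).fderiv, ContinuousLinearMap.flip_apply,
    add_apply, smul_apply, smul_eq_mul,
    ContinuousLinearMap.comp_apply, ContinuousLinearMap.coe_fst', ContinuousLinearMap.coe_snd',
    hsymm.eq e]
  ring

/-- A function whose spatial derivatives all vanish depends on time only. -/
lemma eq_of_spatial_derivs_eq_zero {f : ℝ × ℝ × ℝ × ℝ → ℝ} (hf : Differentiable ℝ f)
    (hx : ∀ p, pX f p = 0) (hy : ∀ p, pY f p = 0) (hz : ∀ p, pZ f p = 0)
    (a b : ℝ × ℝ × ℝ) (t : ℝ) :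
    f (a.1, a.2.1, a.2.2, t) = f (b.1, b.2.1, b.2.2, t) := by
  let ι : ℝ × ℝ × ℝ → ℝ × ℝ × ℝ × ℝ := fun q => (q.1, q.2.1, q.2.2, t)
  have hι : Differentiable ℝ ι := by fun_prop
  refine is_const_of_fderiv_eq_zero (𝕜 := ℝ) (f := f ∘ ι) (hf.comp hι) (fun q => ?_) a b
  have hιq : HasFDerivAt ι ((ContinuousLinearMap.fst ℝ ℝ (ℝ × ℝ)).prod
      (((ContinuousLinearMap.fst ℝ ℝ ℝ).comp (ContinuousLinearMap.snd ℝ ℝ (ℝ × ℝ))).prod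
        (((ContinuousLinearMap.snd ℝ ℝ ℝ).comp (ContinuousLinearMap.snd ℝ ℝ (ℝ × ℝ))).prod
          0))) q :=
    hasFDerivAt_fst.prodMk ((hasFDerivAt_fst.comp q hasFDerivAt_snd).prodMk
      ((hasFDerivAt_snd.comp q hasFDerivAt_snd).prodMk (hasFDerivAt_const t q)))
  rw [((hf (ι q)).hasFDerivAt.comp q hιq).fderiv]
  ext
  · simpa [pX] using hx (ι q)
  · simpa [pY] using hy (ι q)
  · simpa [pZ] using hz (ι q)

/-- With a flat bottom `w(x,y,−d,t) = 0`, the constant vorticity must vanish and the flow is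
purely zonal: `v ≡ 0`, `w ≡ 0`, `u = a(t)`. -/
theorem flat_bottom_zero_vorticity (Λ₁ Λ₂ Λ₃ Ω β d : ℝ) (hΩ : Λ₂ + 2 * Ω ≠ 0) (hβ : 0 < β)
    (u v w : ℝ × ℝ × ℝ × ℝ → ℝ)
    (hu : ContDiff ℝ 2 u) (hv : ContDiff ℝ 2 v) (hw : ContDiff ℝ 2 w)
    (hlin1 : ∀ p : ℝ × ℝ × ℝ × ℝ,
      Λ₁ * pX u p + (Λ₂ + 2 * Ω) * pY u p + (Λ₃ + β * p.2.1) * pZ u p = 0)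
    (hlin2 : ∀ p : ℝ × ℝ × ℝ × ℝ,
      Λ₁ * pX v p + (Λ₂ + 2 * Ω) * pY v p + (Λ₃ + β * p.2.1) * pZ v p = 0)
    (hlin3 : ∀ p : ℝ × ℝ × ℝ × ℝ,
      Λ₁ * pX w p + (Λ₂ + 2 * Ω) * pY w p + (Λ₃ + β * p.2.1) * pZ w p - β * v p = 0)
    (hmass : ∀ p : ℝ × ℝ × ℝ × ℝ, pX u p + pY v p + pZ w p = 0)
    (hvort1 : ∀ p : ℝ × ℝ × ℝ × ℝ, pY w p - pZ v p = Λ₁)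
    (hvort2 : ∀ p : ℝ × ℝ × ℝ × ℝ, pZ u p - pX w p = Λ₂)
    (hvort3 : ∀ p : ℝ × ℝ × ℝ × ℝ, pX v p - pY u p = Λ₃)
    (hbot : ∀ x y t : ℝ, w (x, y, -d, t) = 0) :
    Λ₁ = 0 ∧ Λ₂ = 0 ∧ Λ₃ = 0 ∧
    (∀ p : ℝ × ℝ × ℝ × ℝ, v p = 0) ∧
    (∀ p : ℝ × ℝ × ℝ × ℝ, w p = 0) ∧
    ∃ a : ℝ → ℝ, ∀ p : ℝ × ℝ × ℝ × ℝ, u p = a p.2.2.2 := by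
  have hud := hu.differentiable (by norm_num)
  have hwd := hw.differentiable (by norm_num)
  have Du : ∀ e p, shearDeriv Λ₁ (Λ₂ + 2 * Ω) Λ₃ β (fun q => fderiv ℝ u q e) p
      + β * e.2.1 * pZ u p = 0 := fun e p => by
    simpa using shearDeriv_fderiv_apply _ _ _ _ (g := fun _ => 0) hu hlin1 e p
  have Dv : ∀ e p, shearDeriv Λ₁ (Λ₂ + 2 * Ω) Λ₃ β (fun q => fderiv ℝ v q e) p
      + β * e.2.1 * pZ v p = 0 := fun e p => by
    simpa using shearDeriv_fderiv_apply _ _ _ _ (g := fun _ => 0) hv hlin2 e p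
  have Dw : ∀ e p, shearDeriv Λ₁ (Λ₂ + 2 * Ω) Λ₃ β (fun q => fderiv ℝ w q e) p
      + β * e.2.1 * pZ w p = β * fderiv ℝ v p e := fun e p => by
    rw [shearDeriv_fderiv_apply _ _ _ _ (g := fun q => β * v q) hw
      (fun q => sub_eq_zero.mp (hlin3 q)) e p,
      fderiv_const_mul (hv.differentiable (by norm_num) p)]
    simp
  have hvx : ∀ p, pX v p = 0 := fun p => by
    have h1 := Du (0, 0, 1, 0) p
    have h2 := Dw (1, 0, 0, 0) p
    have h : (fun q => fderiv ℝ u q (0, 0, 1, 0))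
        = fun q => Λ₂ + fderiv ℝ w q (1, 0, 0, 0) :=
      funext fun q => sub_eq_iff_eq_add.mp (hvort2 q)
    rw [h, shearDeriv_const_add] at h1
    simp only [mul_zero, zero_mul, add_zero] at h1 h2
    rw [h1] at h2
    exact (mul_eq_zero.mp h2.symm).resolve_left hβ.ne'
  have huy : ∀ p, pY u p = -Λ₃ := fun p => by linarith [hvort3 p, hvx p]
  have huz : ∀ p, pZ u p = 0 := fun p => by
    have h1 := Du (0, 1, 0, 0) p
    have h : (fun q => fderiv ℝ u q (0, 1, 0, 0)) = fun _ => -Λ₃ := funext huy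
    rw [h, shearDeriv_const] at h1
    simpa [hβ.ne'] using h1
  have hvy : ∀ p, pY v p = pZ w p := fun p => by
    have h1 := Dv (0, 0, 1, 0) p
    have h2 := Dw (0, 1, 0, 0) p
    have h : (fun q => fderiv ℝ w q (0, 1, 0, 0))
        = fun q => Λ₁ + fderiv ℝ v q (0, 0, 1, 0) :=
      funext fun q => sub_eq_iff_eq_add.mp (hvort1 q)
    rw [h, shearDeriv_const_add] at h2
    simp only [mul_zero, zero_mul, add_zero, mul_one] at h1 h2
    rw [h1, zero_add] at h2
    exact (mul_left_cancel₀ hβ.ne' h2).symm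
  have hvz : ∀ p, pZ v p = 0 := fun p => by
    have h1 := Dv (0, 1, 0, 0) p
    have h2 := Dw (0, 0, 1, 0) p
    have h : (fun q => fderiv ℝ v q (0, 1, 0, 0))
        = fun q => fderiv ℝ w q (0, 0, 1, 0) := funext hvy
    rw [h] at h1
    simp only [mul_zero, zero_mul, add_zero, mul_one] at h1 h2
    change _ = β * pZ v p at h2
    have : β * pZ v p = 0 := by linarith
    exact (mul_eq_zero.mp this).resolve_left hβ.ne'
  have hbot_deriv : ∀ a b : ℝ, fderiv ℝ w (0, 0, -d, 0) (a, b, 0, 0) = 0 := fun a b => by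
    have hline : HasDerivAt (fun s : ℝ => ((s * a, s * b, -d, 0) : ℝ × ℝ × ℝ × ℝ))
        (a, b, 0, 0) 0 := by
      simpa using ((hasDerivAt_id (0 : ℝ)).mul_const a).prodMk
        (((hasDerivAt_id (0 : ℝ)).mul_const b).prodMk ((hasDerivAt_const (0 : ℝ) (-d)).prodMk
            (hasDerivAt_const (0 : ℝ) (0 : ℝ))))
    have hw0 : HasFDerivAt w (fderiv ℝ w (0, 0, -d, 0)) (0 * a, 0 * b, -d, 0) := by
      simpa using (hwd (0, 0, -d, 0)).hasFDerivAt
    have hcomp := hw0.comp_hasDerivAt (0 : ℝ) hline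
    have hzero : (w ∘ fun s : ℝ => ((s * a, s * b, -d, 0) : ℝ × ℝ × ℝ × ℝ)) = fun _ => 0 :=
      funext fun s => hbot _ _ _
    rw [hzero] at hcomp
    exact hcomp.unique (hasDerivAt_const _ _)
  have hΛ₂ : Λ₂ = 0 := by
    have h : pX w (0, 0, -d, 0) = 0 := hbot_deriv 1 0
    linarith [hvort2 (0, 0, -d, 0), huz (0, 0, -d, 0)]
  have hΛ₁ : Λ₁ = 0 := by
    have h : pY w (0, 0, -d, 0) = 0 := hbot_deriv 0 1
    linarith [hvort1 (0, 0, -d, 0), hvz (0, 0, -d, 0)]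
  have hΛ₃ : Λ₃ = 0 := by
    have h := hlin1 0
    rw [hΛ₁, huy, huz] at h
    simpa [hΩ] using h
  have hvy0 : ∀ p, pY v p = 0 := fun p => by
    have h := hlin2 p
    rw [hΛ₁, hvz] at h
    simpa [hΩ] using h
  have hwx : ∀ p, pX w p = 0 := fun p => by linarith [hvort2 p, huz p]
  have hwy : ∀ p, pY w p = 0 := fun p => by linarith [hvort1 p, hvz p]
  have hwz : ∀ p, pZ w p = 0 := fun p => (hvy p).symm.trans (hvy0 p)
  refine ⟨hΛ₁, hΛ₂, hΛ₃, fun p => ?_, fun p => ?_, fun t => u (0, 0, 0, t), fun p => ?_⟩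
  · have h := hlin3 p
    rw [hwx, hwy, hwz] at h
    simpa [hβ.ne'] using h
  · exact (eq_of_spatial_derivs_eq_zero hwd hwx hwy hwz (p.1, p.2.1, p.2.2.1) (0, 0, -d)
      p.2.2.2).trans (hbot _ _ _)
  · exact eq_of_spatial_derivs_eq_zero hud
      (fun q => by linarith [hmass q, hvy0 q, hwz q]) (fun q => by rw [huy, hΛ₃, neg_zero]) huz
      (p.1, p.2.1, p.2.2.1) (0, 0, 0) p.2.2.2
end

section
/- Let Ω, β be real constants and ρ > 0, and let a : ℝ → ℝ be C¹. Suppose the velocity field u(x,y,z,t) = a(t), v ≡ 0, w ≡ 0 together with a C¹ function P̃ : ℝ⁴ → ℝ satisfies the transformed β-plane system u_t + u u_x + v u_y + w u_z + 2Ω w − β y v = −P̃_x/ρ, v_t + u v_x + v v_y + w v_z + β y u = −P̃_y/ρ, w_t + u w_x + v w_y + w w_z − 2Ω u = −P̃_z/ρ on all of ℝ⁴. Then there exists a function c : ℝ → ℝ such that P̃(x,y,z,t) = ρ ( −a'(t) x − (β/2) a(t) y² + 2Ω a(t) z + c(t) ) for all (x,y,z,t) ∈ ℝ⁴. -/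
theorem fderiv_apply_eq_partials (f : ℝ × ℝ × ℝ × ℝ → ℝ) (p : ℝ × ℝ × ℝ × ℝ) (x y z t : ℝ) :
    fderiv ℝ f p (x, y, z, t) = x * pX f p + y * pY f p + z * pZ f p + t * pT f p := by
  have h : ((x, y, z, t) : ℝ × ℝ × ℝ × ℝ) =
      x • (1, 0, 0, 0) + y • (0, 1, 0, 0) + z • (0, 0, 1, 0) + t • (0, 0, 0, 1) := by
    simp
  rw [h]
  simp only [map_add, map_smul, smul_eq_mul, pX, pY, pZ, pT]

theorem fderiv_comp_time {a : ℝ → ℝ} (ha : Differentiable ℝ a) (p q : ℝ × ℝ × ℝ × ℝ) :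
    fderiv ℝ (fun p : ℝ × ℝ × ℝ × ℝ => a p.2.2.2) p q = q.2.2.2 * deriv a p.2.2.2 := by
  have h : HasFDerivAt (fun p : ℝ × ℝ × ℝ × ℝ => p.2.2.2)
      ((ContinuousLinearMap.snd ℝ ℝ ℝ).comp ((ContinuousLinearMap.snd ℝ ℝ (ℝ × ℝ)).comp
        (ContinuousLinearMap.snd ℝ ℝ (ℝ × ℝ × ℝ)))) p :=
    hasFDerivAt_snd.comp p (hasFDerivAt_snd.comp p hasFDerivAt_snd)
  have h' := ((ha p.2.2.2).hasDerivAt.comp_hasFDerivAt p h).fderiv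
  simp only [Function.comp_def] at h'
  rw [h']
  simp [mul_comm]

/-- A function whose spatial gradient at time `t` is `(A, B y, C)` is determined up to its
value at the spatial origin. -/
theorem eq_of_spatial_gradient {f : ℝ × ℝ × ℝ × ℝ → ℝ} (hf : Differentiable ℝ f)
    {A B C t : ℝ} (hx : ∀ x y z, pX f (x, y, z, t) = A)
    (hy : ∀ x y z, pY f (x, y, z, t) = B * y) (hz : ∀ x y z, pZ f (x, y, z, t) = C)
    (x y z : ℝ) :
    f (x, y, z, t) = A * x + B / 2 * y ^ 2 + C * z + f (0, 0, 0, t) := by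
  have hderiv (s : ℝ) : HasDerivAt
      (fun s : ℝ => f (s * x, s * y, s * z, t) -
        (s * (A * x) + s ^ 2 * (B / 2 * y ^ 2) + s * (C * z))) 0 s := by
    have hl (r : ℝ) : HasDerivAt (fun s : ℝ => s * r) r s := by
      simpa using (hasDerivAt_id s).mul_const r
    have hγ : HasDerivAt (fun s : ℝ => ((s * x, s * y, s * z, t) : ℝ × ℝ × ℝ × ℝ))
        (x, y, z, 0) s :=
      (hl x).prodMk ((hl y).prodMk ((hl z).prodMk (hasDerivAt_const s t)))
    have h := ((hf (s * x, s * y, s * z, t)).hasFDerivAt.comp_hasDerivAt s hγ).sub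
      (((hl (A * x)).add ((hasDerivAt_pow 2 s).mul_const (B / 2 * y ^ 2))).add (hl (C * z)))
    rw [fderiv_apply_eq_partials, hx, hy, hz] at h
    refine h.congr_deriv ?_
    push_cast
    ring
  have h := is_const_of_deriv_eq_zero (fun s => (hderiv s).differentiableAt)
    (fun s => (hderiv s).deriv) 1 0
  norm_num at h
  linarith

/-- For the purely zonal flow `u = a(t)`, `v ≡ 0`, `w ≡ 0`, the transformed β-plane system
determines the modified pressure `P̃ = ρ(−a'(t)x − (β/2)a(t)y² + 2Ωa(t)z + c(t))`. -/
theorem pressure_from_zonal_flow (Ω β ρ : ℝ) (hρ : 0 < ρ)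
    (a : ℝ → ℝ) (ha : ContDiff ℝ 1 a)
    (u v w Ptil : ℝ × ℝ × ℝ × ℝ → ℝ)
    (hudef : ∀ p : ℝ × ℝ × ℝ × ℝ, u p = a p.2.2.2)
    (hvdef : ∀ p : ℝ × ℝ × ℝ × ℝ, v p = 0)
    (hwdef : ∀ p : ℝ × ℝ × ℝ × ℝ, w p = 0)
    (hPtil : ContDiff ℝ 1 Ptil)
    (heq1 : ∀ p : ℝ × ℝ × ℝ × ℝ,
      pT u p + u p * pX u p + v p * pY u p + w p * pZ u p + 2 * Ω * w p
        - β * p.2.1 * v p = -(pX Ptil p) / ρ)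
    (heq2 : ∀ p : ℝ × ℝ × ℝ × ℝ,
      pT v p + u p * pX v p + v p * pY v p + w p * pZ v p + β * p.2.1 * u p
        = -(pY Ptil p) / ρ)
    (heq3 : ∀ p : ℝ × ℝ × ℝ × ℝ,
      pT w p + u p * pX w p + v p * pY w p + w p * pZ w p - 2 * Ω * u p
        = -(pZ Ptil p) / ρ) :
    ∃ c : ℝ → ℝ, ∀ p : ℝ × ℝ × ℝ × ℝ,
      Ptil p = ρ * (-(deriv a p.2.2.2) * p.1 - β / 2 * a p.2.2.2 * p.2.1 ^ 2
        + 2 * Ω * a p.2.2.2 * p.2.2.1 + c p.2.2.2) := by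
  obtain rfl : u = fun p => a p.2.2.2 := funext hudef
  obtain rfl : v = fun _ => 0 := funext hvdef
  obtain rfl : w = fun _ => 0 := funext hwdef
  have had := ha.differentiable one_ne_zero
  refine ⟨fun t => Ptil (0, 0, 0, t) / ρ, fun ⟨x, y, z, t⟩ => ?_⟩
  have h := eq_of_spatial_gradient (hPtil.differentiable one_ne_zero) (t := t)
    (A := -ρ * deriv a t) (B := -ρ * β * a t) (C := 2 * ρ * Ω * a t)
    (fun x y z => by
      have h := heq1 (x, y, z, t)
      simp only [pT, pX, pY, pZ, fderiv_comp_time had] at h ⊢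
      field_simp at h
      linarith)
    (fun x y z => by
      have h := heq2 (x, y, z, t)
      simp [pT, pX, pY, pZ] at h ⊢
      field_simp at h
      linarith)
    (fun x y z => by
      have h := heq3 (x, y, z, t)
      simp [pT, pX, pY, pZ] at h ⊢
      field_simp at h
      linarith) x y z
  rw [h]
  field_simp
  ring
end

section
/- (Theorem 1, transformed form.) Let Ω, R, g, d be real constants, β > 0, ρ₁ > 0, and let Λ₁, Λ₂, Λ₃ be real constants with Λ₂ + 2Ω ≠ 0. Suppose u₁, v₁, w₁ : ℝ⁴ → ℝ are C² and P̃₁ : ℝ⁴ → ℝ is C², satisfying: (i) the transformed β-plane system u_t + u u_x + v u_y + w u_z + 2Ω w − β y v = −P̃_x/ρ₁, v_t + u v_x + v v_y + w v_z + β y u = −P̃_y/ρ₁, w_t + u w_x + v w_y + w w_z − 2Ω u = −P̃_z/ρ₁ (with (u,v,w,P̃) = (u₁,v₁,w₁,P̃₁)); (ii) mass conservation u_x + v_y + w_z = 0; (iii) constant vorticity (w_y − v_z, u_z − w_x, v_x − u_y) = (Λ₁, Λ₂, Λ₃); (iv) the flat-bottom condition w₁(x, y, −d, t) = 0 for all x,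 y, t. Define the physical pressure P₁ = P̃₁ + ρ₁ Ω² y²/2 − ρ₁ (Ω² R − g) z. Assume further there is a differentiable surface η₁ : ℝ³ → ℝ (function of (x,y,t)) with |∂_y η₁| bounded, such that for each fixed (x,t) the function y ↦ (P₁)_y + (P₁)_z · ∂_y η₁ evaluated at z = η₁(x,y,t) is bounded on ℝ. Then u₁ ≡ Ω²/β, v₁ ≡ 0, w₁ ≡ 0, and there exists c₁ : ℝ → ℝ with P₁(x,y,z,t) = ρ₁ [ (2Ω³/β − Ω² R + g) z + c₁(t) ]. -/
/-- Partial derivative in the `y` direction on `ℝ³` with coordinates `(x,y,t)`. -/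
noncomputable def sY (η : ℝ × ℝ × ℝ → ℝ) (q : ℝ × ℝ × ℝ) : ℝ :=
  fderiv ℝ η q (0, 1, 0)

/-- Directional derivative of `f` at `p` along `e`. -/
noncomputable def dirDeriv (e : ℝ × ℝ × ℝ × ℝ) (f : ℝ × ℝ × ℝ × ℝ → ℝ)
    (p : ℝ × ℝ × ℝ × ℝ) : ℝ :=
  fderiv ℝ f p e

theorem pX_eq_dirDeriv (f : ℝ × ℝ × ℝ × ℝ → ℝ) : pX f = dirDeriv (1, 0, 0, 0) f := rfl

theorem pY_eq_dirDeriv (f : ℝ × ℝ × ℝ × ℝ → ℝ) : pY f = dirDeriv (0, 1, 0, 0) f := rfl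

theorem pZ_eq_dirDeriv (f : ℝ × ℝ × ℝ × ℝ → ℝ) : pZ f = dirDeriv (0, 0, 1, 0) f := rfl

theorem pT_eq_dirDeriv (f : ℝ × ℝ × ℝ × ℝ → ℝ) : pT f = dirDeriv (0, 0, 0, 1) f := rfl

section DirDeriv

variable {f g : ℝ × ℝ × ℝ × ℝ → ℝ} (e e' p : ℝ × ℝ × ℝ × ℝ)

theorem dirDeriv_add (hf : Differentiable ℝ f) (hg : Differentiable ℝ g) :
    dirDeriv e (fun q => f q + g q) p = dirDeriv e f p + dirDeriv e g p := by
  simp [dirDeriv, fderiv_fun_add (hf p) (hg p)]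

theorem dirDeriv_sub (hf : Differentiable ℝ f) (hg : Differentiable ℝ g) :
    dirDeriv e (fun q => f q - g q) p = dirDeriv e f p - dirDeriv e g p := by
  simp [dirDeriv, fderiv_fun_sub (hf p) (hg p)]

theorem dirDeriv_mul (hf : Differentiable ℝ f) (hg : Differentiable ℝ g) :
    dirDeriv e (fun q => f q * g q) p = f p * dirDeriv e g p + g p * dirDeriv e f p := by
  simp [dirDeriv, fderiv_fun_mul (hf p) (hg p)]

theorem dirDeriv_const (c : ℝ) : dirDeriv e (fun _ => c) p = 0 := by
  simp [dirDeriv]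

theorem dirDeriv_y : dirDeriv e (fun q => q.2.1) p = e.2.1 := by
  have h : HasFDerivAt (fun q : ℝ × ℝ × ℝ × ℝ => q.2.1)
      ((ContinuousLinearMap.fst ℝ ℝ (ℝ × ℝ)).comp
        (ContinuousLinearMap.snd ℝ ℝ (ℝ × ℝ × ℝ))) p :=
    ((ContinuousLinearMap.fst ℝ ℝ (ℝ × ℝ)).comp
        (ContinuousLinearMap.snd ℝ ℝ (ℝ × ℝ × ℝ))).hasFDerivAt
  simp [dirDeriv, h.fderiv]

theorem dirDeriv_z : dirDeriv e (fun q => q.2.2.1) p = e.2.2.1 := by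
  have h : HasFDerivAt (fun q : ℝ × ℝ × ℝ × ℝ => q.2.2.1)
      ((ContinuousLinearMap.fst ℝ ℝ ℝ).comp ((ContinuousLinearMap.snd ℝ ℝ (ℝ × ℝ)).comp
        (ContinuousLinearMap.snd ℝ ℝ (ℝ × ℝ × ℝ)))) p :=
    ((ContinuousLinearMap.fst ℝ ℝ ℝ).comp ((ContinuousLinearMap.snd ℝ ℝ (ℝ × ℝ)).comp
        (ContinuousLinearMap.snd ℝ ℝ (ℝ × ℝ × ℝ)))).hasFDerivAt
  simp [dirDeriv, h.fderiv]

theorem ContDiff.differentiable_dirDeriv (hf : ContDiff ℝ 2 f) :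
    Differentiable ℝ (dirDeriv e f) := by
  have h : ContDiff ℝ 1 (fderiv ℝ f) := hf.fderiv_right (by norm_num)
  exact (h.differentiable (by norm_num)).clm_apply (differentiable_const e)

theorem dirDeriv_comm (hf : ContDiff ℝ 2 f) :
    dirDeriv e (dirDeriv e' f) p = dirDeriv e' (dirDeriv e f) p := by
  have h : ContDiff ℝ 1 (fderiv ℝ f) := hf.fderiv_right (by norm_num)
  have hd : DifferentiableAt ℝ (fderiv ℝ f) p := h.differentiable (by norm_num) p
  have key (a b : ℝ × ℝ × ℝ × ℝ) :
      dirDeriv a (dirDeriv b f) p = fderiv ℝ (fderiv ℝ f) p a b := by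
    change fderiv ℝ (fun q => fderiv ℝ f q b) p a = _
    rw [fderiv_clm_apply hd (differentiableAt_const b)]
    simp
  rw [key, key]
  exact (hf.contDiffAt.isSymmSndFDerivAt (by simp)) e e'

theorem hasDerivAt_comp_curve (hf : Differentiable ℝ f) {γ : ℝ → ℝ × ℝ × ℝ × ℝ} {s : ℝ}
    (hγ : HasDerivAt γ e s) : HasDerivAt (fun r => f (γ r)) (dirDeriv e f (γ s)) s :=
  (hf (γ s)).hasFDerivAt.comp_hasDerivAt s hγ

end DirDeriv

section Slices

variable {f : ℝ × ℝ × ℝ × ℝ → ℝ}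

theorem hasDerivAt_slice_x (hf : Differentiable ℝ f) (x y z t : ℝ) :
    HasDerivAt (fun s => f (s, y, z, t)) (pX f (x, y, z, t)) x :=
  hasDerivAt_comp_curve _ hf
    (γ := fun s => (s, y, z, t)) ((hasDerivAt_id x).prodMk (hasDerivAt_const x (y, z, t)))

theorem hasDerivAt_slice_y (hf : Differentiable ℝ f) (x y z t : ℝ) :
    HasDerivAt (fun s => f (x, s, z, t)) (pY f (x, y, z, t)) y :=
  hasDerivAt_comp_curve _ hf (γ := fun s => (x, s, z, t))
    ((hasDerivAt_const y x).prodMk ((hasDerivAt_id y).prodMk (hasDerivAt_const y (z, t))))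

theorem hasDerivAt_slice_z (hf : Differentiable ℝ f) (x y z t : ℝ) :
    HasDerivAt (fun s => f (x, y, s, t)) (pZ f (x, y, z, t)) z :=
  hasDerivAt_comp_curve _ hf (γ := fun s => (x, y, s, t))
    ((hasDerivAt_const z x).prodMk ((hasDerivAt_const z y).prodMk
      ((hasDerivAt_id z).prodMk (hasDerivAt_const z t))))

theorem eq_of_hasDerivAt_zero {h : ℝ → ℝ} (hh : ∀ s, HasDerivAt h 0 s) (a b : ℝ) : h a = h b :=
  is_const_of_deriv_eq_zero (fun s => (hh s).differentiableAt) (fun s => (hh s).deriv) a b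

theorem eq_of_pX_eq_zero (hf : Differentiable ℝ f) (h : ∀ p, pX f p = 0) (x x' y z t : ℝ) :
    f (x, y, z, t) = f (x', y, z, t) :=
  eq_of_hasDerivAt_zero (h := fun s => f (s, y, z, t))
    (fun s => h (s, y, z, t) ▸ hasDerivAt_slice_x hf s y z t) x x'

theorem eq_of_pY_eq_zero (hf : Differentiable ℝ f) (h : ∀ p, pY f p = 0) (x y y' z t : ℝ) :
    f (x, y, z, t) = f (x, y', z, t) :=
  eq_of_hasDerivAt_zero (h := fun s => f (x, s, z, t))
    (fun s => h (x, s, z, t) ▸ hasDerivAt_slice_y hf x s z t) y y'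

theorem eq_of_pZ_eq_zero (hf : Differentiable ℝ f) (h : ∀ p, pZ f p = 0) (x y z z' t : ℝ) :
    f (x, y, z, t) = f (x, y, z', t) :=
  eq_of_hasDerivAt_zero (h := fun s => f (x, y, s, t))
    (fun s => h (x, y, s, t) ▸ hasDerivAt_slice_z hf x y s t) z z'

/-- A function with vanishing spatial gradient depends on `t` only. -/
theorem eq_at_origin_of_grad_eq_zero (hf : Differentiable ℝ f) (hx : ∀ p, pX f p = 0)
    (hy : ∀ p, pY f p = 0) (hz : ∀ p, pZ f p = 0) (x y z t : ℝ) :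
    f (x, y, z, t) = f (0, 0, 0, t) := by
  rw [eq_of_pX_eq_zero hf hx x 0, eq_of_pY_eq_zero hf hy 0 y 0, eq_of_pZ_eq_zero hf hz 0 0 z 0]

theorem affine_in_z (hf : ContDiff ℝ 2 f) (h : ∀ p, pZ (pZ f) p = 0) (x y z t : ℝ) :
    f (x, y, z, t) = f (x, y, 0, t) + pZ f (x, y, 0, t) * z := by
  have hd : Differentiable ℝ f := hf.differentiable (by norm_num)
  have hd' : Differentiable ℝ (pZ f) := hf.differentiable_dirDeriv _
  have key (s : ℝ) :
      HasDerivAt (fun s => f (x, y, s, t) - pZ f (x, y, 0, t) * s) 0 s := by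
    have h1 := (hasDerivAt_slice_z hd x y s t).sub
      ((hasDerivAt_id s).const_mul (pZ f (x, y, 0, t)))
    rw [eq_of_pZ_eq_zero hd' h x y s 0 t] at h1
    exact h1.congr_deriv (by simp)
  have := eq_of_hasDerivAt_zero key z 0
  simp only [mul_zero, sub_zero] at this
  linarith

end Slices

/-- `f` is constant along the integral curves of `k ∂_x + ∂_y + φ'(y) ∂_z`, normalised by
`φ 0 = 0`, and hence determined by its values on `y = 0`. -/
def ShearInvariant (k : ℝ) (φ : ℝ → ℝ) (f : ℝ × ℝ × ℝ × ℝ → ℝ) : Prop :=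
  ∀ x y z t : ℝ, f (x, y, z, t) = f (x - k * y, 0, z - φ y, t)

namespace ShearInvariant

variable {k : ℝ} {φ : ℝ → ℝ} {f : ℝ × ℝ × ℝ × ℝ → ℝ}

protected theorem pX (hf : Differentiable ℝ f) (h : ShearInvariant k φ f) :
    ShearInvariant k φ (pX f) := by
  intro x y z t
  rw [← (hasDerivAt_slice_x hf x y z t).deriv, ← (hasDerivAt_slice_x hf _ 0 _ t).deriv]
  simp_rw [h _ y z t]
  exact deriv_comp_sub_const (f := fun s => f (s, 0, z - φ y, t)) (k * y) x

protected theorem pZ (hf : Differentiable ℝ f) (h : ShearInvariant k φ f) :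
    ShearInvariant k φ (pZ f) := by
  intro x y z t
  rw [← (hasDerivAt_slice_z hf x y z t).deriv, ← (hasDerivAt_slice_z hf _ 0 _ t).deriv]
  simp_rw [h x y _ t]
  exact deriv_comp_sub_const (f := fun s => f (x - k * y, 0, s, t)) (φ y) z

theorem apply_shift (h : ShearInvariant k φ f) (x y z t : ℝ) :
    f (x + k * y, y, z + φ y, t) = f (x, 0, z, t) := by
  rw [h]; simp

theorem of_transport (hf : Differentiable ℝ f) {φ' : ℝ → ℝ} (hφ : ∀ y, HasDerivAt φ (φ' y) y)
    (hφ0 : φ 0 = 0)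
    (h : ∀ p, k * pX f p + pY f p + φ' p.2.1 * pZ f p = 0) : ShearInvariant k φ f := by
  intro x y z t
  have key (s : ℝ) :
      HasDerivAt (fun s => f (x - k * y + k * s, s, z - φ y + φ s, t)) 0 s := by
    have hγ : HasDerivAt (fun s => ((x - k * y + k * s, s, z - φ y + φ s, t) : ℝ × ℝ × ℝ × ℝ))
        (k, 1, φ' s, 0) s := by
      refine HasDerivAt.prodMk ?_ ((hasDerivAt_id s).prodMk
        (HasDerivAt.prodMk ?_ (hasDerivAt_const s t)))
      · simpa using ((hasDerivAt_id s).const_mul k).const_add (x - k * y)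
      · exact (hφ s).const_add _
    have h1 := hasDerivAt_comp_curve _ hf hγ
    convert h1 using 1
    refine (h (x - k * y + k * s, s, z - φ y + φ s, t)).symm.trans ?_
    have : ((k, 1, φ' s, 0) : ℝ × ℝ × ℝ × ℝ)
        = k • (1, 0, 0, 0) + (0, 1, 0, 0) + φ' s • (0, 0, 1, 0) := by simp
    rw [this]
    simp only [dirDeriv, map_add, map_smul, smul_eq_mul, pX, pY, pZ]
  have := eq_of_hasDerivAt_zero key y 0
  simpa [hφ0] using this

end ShearInvariant

theorem dirDeriv_transport {k m b : ℝ} {f : ℝ × ℝ × ℝ × ℝ → ℝ} (hf : ContDiff ℝ 2 f)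
    (h : ∀ p, k * pX f p + pY f p + (m + b * p.2.1) * pZ f p = 0) (e p : ℝ × ℝ × ℝ × ℝ) :
    k * dirDeriv e (pX f) p + dirDeriv e (pY f) p + (m + b * p.2.1) * dirDeriv e (pZ f) p
      + b * e.2.1 * pZ f p = 0 := by
  have hX : Differentiable ℝ (pX f) := hf.differentiable_dirDeriv _
  have hY : Differentiable ℝ (pY f) := hf.differentiable_dirDeriv _
  have hZ : Differentiable ℝ (pZ f) := hf.differentiable_dirDeriv _
  have h' := congrArg (fun F => dirDeriv e F p) (funext h)
  simp (disch := fun_prop) only [dirDeriv_add, dirDeriv_mul, dirDeriv_const, dirDeriv_y] at h'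
  linear_combination h'

theorem pZ_pZ_eq_zero_of_transport {k m b : ℝ} (hb : b ≠ 0) {f A B : ℝ × ℝ × ℝ × ℝ → ℝ}
    (hf : ContDiff ℝ 2 f)
    (h : ∀ p, k * pX f p + pY f p + (m + b * p.2.1) * pZ f p = 0)
    {φ : ℝ → ℝ} (hφ : ShearInvariant k φ f) (hA : ShearInvariant k φ A)
    (hB : ShearInvariant k φ B)
    (hΔ : ∀ p, pX (pX f) p + pY (pY f) p + pZ (pZ f) p = A p + p.2.1 * B p)
    (p : ℝ × ℝ × ℝ × ℝ) : pZ (pZ f) p = 0 := by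
  have hd : Differentiable ℝ f := hf.differentiable (by norm_num)
  have hX : Differentiable ℝ (pX f) := hf.differentiable_dirDeriv _
  have hZ : Differentiable ℝ (pZ f) := hf.differentiable_dirDeriv _
  have key (p : ℝ × ℝ × ℝ × ℝ) :
      (1 + k ^ 2) * pX (pX f) p + 2 * k * (m + b * p.2.1) * pX (pZ f) p
        + (1 + (m + b * p.2.1) ^ 2) * pZ (pZ f) p - b * pZ f p - A p - p.2.1 * B p = 0 := by
    have h1 := dirDeriv_transport hf h (1, 0, 0, 0) p
    have h2 := dirDeriv_transport hf h (0, 1, 0, 0) p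
    have h3 := dirDeriv_transport hf h (0, 0, 1, 0) p
    have hxy : pX (pY f) p = pY (pX f) p := dirDeriv_comm _ _ _ hf
    have hxz : pX (pZ f) p = pZ (pX f) p := dirDeriv_comm _ _ _ hf
    have hyz : pY (pZ f) p = pZ (pY f) p := dirDeriv_comm _ _ _ hf
    simp only [← pX_eq_dirDeriv, ← pY_eq_dirDeriv, ← pZ_eq_dirDeriv] at h1 h2 h3
    rw [← hxy, hyz] at h2
    rw [← hxz] at h3
    linear_combination hΔ p + k * h1 - h2 + (m + b * p.2.1) * h3
  have hfz := hφ.pZ hd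
  have hxx := (hφ.pX hd).pX hX
  have hxz := hfz.pX hZ
  have hzz := hfz.pZ hZ
  obtain ⟨x, y, z, t⟩ := p
  rw [hzz x y z t]
  generalize x - k * y = x', z - φ y = z'
  have base (s : ℝ) := key (x' + k * s, s, z' + φ s, t)
  simp only [hfz.apply_shift, hxx.apply_shift, hxz.apply_shift, hzz.apply_shift,
    hA.apply_shift, hB.apply_shift] at base
  have : (2 * b ^ 2) * pZ (pZ f) (x', 0, z', t) = 0 := by
    linear_combination base 1 + base (-1) - 2 * base 0
  simpa [hb] using this

theorem eq_zero_of_bottom {b m k d : ℝ} (hb : b ≠ 0) {v q : ℝ × ℝ × ℝ × ℝ → ℝ}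
    (hv : ContDiff ℝ 2 v) (hq : ContDiff ℝ 2 q)
    (hvs : ShearInvariant k (fun y => m * y + b / 2 * y ^ 2) v)
    (hqs : ShearInvariant k (fun y => m * y + b / 2 * y ^ 2) q)
    (hvzz : ∀ p, pZ (pZ v) p = 0) (hqzz : ∀ p, pZ (pZ q) p = 0)
    (hbot : ∀ x y t : ℝ, q (x, y, -d, t) + b * y * v (x, y, -d, t) = 0) :
    (∀ p, v p = 0) ∧ ∀ p, q p = 0 := by
  have base (x y t : ℝ) := hbot (x + k * y) y t
  simp only [hvs _ _ (-d) _, hqs _ _ (-d) _, add_sub_cancel_right] at base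
  have hva := affine_in_z hv hvzz
  have hqa := affine_in_z hq hqzz
  have coeffs (x t : ℝ) : v (x, 0, 0, t) = 0 ∧ pZ v (x, 0, 0, t) = 0 ∧
      q (x, 0, 0, t) = 0 ∧ pZ q (x, 0, 0, t) = 0 := by
    have e (y : ℝ) := base x y t
    simp only [hva x 0 (_ - _), hqa x 0 (_ - _)] at e
    have e0 := e 0
    have e1 := e 1
    have e2 := e (-1)
    have e3 := e 2
    have hBv : pZ v (x, 0, 0, t) = 0 := by
      have : (3 * b ^ 2) * pZ v (x, 0, 0, t) = 0 := by
        linear_combination -(e3 - 3 * e1 + 3 * e0 - e2)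
      simpa [hb] using this
    simp only [hBv] at e0 e1 e2 e3
    have hBq : pZ q (x, 0, 0, t) = 0 := by
      have : b * pZ q (x, 0, 0, t) = 0 := by linear_combination -(e1 + e2 - 2 * e0)
      simpa [hb] using this
    simp only [hBq] at e0 e1 e2 e3
    have hAv : v (x, 0, 0, t) = 0 := by
      have : b * v (x, 0, 0, t) = 0 := by linear_combination e1 - e0
      simpa [hb] using this
    exact ⟨hAv, hBv, by linear_combination e0, hBq⟩
  constructor
  · rintro ⟨x, y, z, t⟩
    rw [hvs, hva, (coeffs _ t).1, (coeffs _ t).2.1]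
    simp
  · rintro ⟨x, y, z, t⟩
    rw [hqs, hqa, (coeffs _ t).2.2.1, (coeffs _ t).2.2.2]
    simp

theorem dirDeriv_advection {u v w f : ℝ × ℝ × ℝ × ℝ → ℝ} (hu : ContDiff ℝ 2 u)
    (hv : ContDiff ℝ 2 v) (hw : ContDiff ℝ 2 w) (hf : ContDiff ℝ 2 f)
    (e p : ℝ × ℝ × ℝ × ℝ) :
    dirDeriv e (fun p => pT f p + u p * pX f p + v p * pY f p + w p * pZ f p) p
      = pT (dirDeriv e f) p + u p * pX (dirDeriv e f) p + v p * pY (dirDeriv e f) p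
        + w p * pZ (dirDeriv e f) p + dirDeriv e u p * pX f p + dirDeriv e v p * pY f p
        + dirDeriv e w p * pZ f p := by
  have hu' : Differentiable ℝ u := hu.differentiable (by norm_num)
  have hv' : Differentiable ℝ v := hv.differentiable (by norm_num)
  have hw' : Differentiable ℝ w := hw.differentiable (by norm_num)
  have hfd := fun e => hf.differentiable_dirDeriv e
  simp only [pX_eq_dirDeriv, pY_eq_dirDeriv, pZ_eq_dirDeriv, pT_eq_dirDeriv]
  simp (disch := fun_prop) only [dirDeriv_add, dirDeriv_mul]
  rw [dirDeriv_comm e (1, 0, 0, 0) p hf, dirDeriv_comm e (0, 1, 0, 0) p hf,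
    dirDeriv_comm e (0, 0, 1, 0) p hf, dirDeriv_comm e (0, 0, 0, 1) p hf]
  ring

theorem differentiable_advection {u v w f : ℝ × ℝ × ℝ × ℝ → ℝ} (hu : ContDiff ℝ 2 u)
    (hv : ContDiff ℝ 2 v) (hw : ContDiff ℝ 2 w) (hf : ContDiff ℝ 2 f) :
    Differentiable ℝ (fun p => pT f p + u p * pX f p + v p * pY f p + w p * pZ f p) := by
  have hu' : Differentiable ℝ u := hu.differentiable (by norm_num)
  have hv' : Differentiable ℝ v := hv.differentiable (by norm_num)
  have hw' : Differentiable ℝ w := hw.differentiable (by norm_num)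
  have hfd := fun e => hf.differentiable_dirDeriv e
  simp only [pX_eq_dirDeriv, pY_eq_dirDeriv, pZ_eq_dirDeriv, pT_eq_dirDeriv]
  fun_prop

section Vorticity

variable {u v w P : ℝ × ℝ × ℝ × ℝ → ℝ} {Ω β ρ Λ₁ Λ₂ Λ₃ : ℝ}

theorem dirDeriv_constraint_sub {f g : ℝ × ℝ × ℝ × ℝ → ℝ} {e₁ e₂ : ℝ × ℝ × ℝ × ℝ} {c : ℝ}
    (hf : ContDiff ℝ 2 f) (hg : ContDiff ℝ 2 g)
    (h : ∀ p, dirDeriv e₁ f p - dirDeriv e₂ g p = c) (e p : ℝ × ℝ × ℝ × ℝ) :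
    dirDeriv e (dirDeriv e₁ f) p = dirDeriv e (dirDeriv e₂ g) p := by
  have h' := congrArg (fun F => dirDeriv e F p) (funext h)
  simp only [dirDeriv_sub e p (hf.differentiable_dirDeriv e₁) (hg.differentiable_dirDeriv e₂),
    dirDeriv_const] at h'
  linarith

theorem dirDeriv_mass (hu : ContDiff ℝ 2 u) (hv : ContDiff ℝ 2 v) (hw : ContDiff ℝ 2 w)
    (hmass : ∀ p, pX u p + pY v p + pZ w p = 0) (e p : ℝ × ℝ × ℝ × ℝ) :
    dirDeriv e (pX u) p + dirDeriv e (pY v) p + dirDeriv e (pZ w) p = 0 := by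
  have hX : Differentiable ℝ (pX u) := hu.differentiable_dirDeriv _
  have hY : Differentiable ℝ (pY v) := hv.differentiable_dirDeriv _
  have hZ : Differentiable ℝ (pZ w) := hw.differentiable_dirDeriv _
  have h' := congrArg (fun F => dirDeriv e F p) (funext hmass)
  simpa (disch := fun_prop) only [dirDeriv_add, dirDeriv_const] using h'

/-- The vorticity equation for constant vorticity `(Λ₁, Λ₂, Λ₃)` on the `β`-plane. -/
theorem vorticity_equation (hu : ContDiff ℝ 2 u) (hv : ContDiff ℝ 2 v) (hw : ContDiff ℝ 2 w)
    (hP : ContDiff ℝ 2 P)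
    (heq1 : ∀ p : ℝ × ℝ × ℝ × ℝ,
      pT u p + u p * pX u p + v p * pY u p + w p * pZ u p + 2 * Ω * w p
        - β * p.2.1 * v p = -(pX P p) / ρ)
    (heq2 : ∀ p : ℝ × ℝ × ℝ × ℝ,
      pT v p + u p * pX v p + v p * pY v p + w p * pZ v p + β * p.2.1 * u p
        = -(pY P p) / ρ)
    (heq3 : ∀ p : ℝ × ℝ × ℝ × ℝ,
      pT w p + u p * pX w p + v p * pY w p + w p * pZ w p - 2 * Ω * u p
        = -(pZ P p) / ρ)
    (hmass : ∀ p, pX u p + pY v p + pZ w p = 0)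
    (hvort1 : ∀ p, pY w p - pZ v p = Λ₁)
    (hvort2 : ∀ p, pZ u p - pX w p = Λ₂)
    (hvort3 : ∀ p, pX v p - pY u p = Λ₃) (p : ℝ × ℝ × ℝ × ℝ) :
    Λ₁ * pX u p + (Λ₂ + 2 * Ω) * pY u p + (Λ₃ + β * p.2.1) * pZ u p = 0 ∧
    Λ₁ * pX v p + (Λ₂ + 2 * Ω) * pY v p + (Λ₃ + β * p.2.1) * pZ v p = 0 ∧
    Λ₁ * pX w p + (Λ₂ + 2 * Ω) * pY w p + (Λ₃ + β * p.2.1) * pZ w p = β * v p := by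
  have hu' : Differentiable ℝ u := hu.differentiable (by norm_num)
  have hv' : Differentiable ℝ v := hv.differentiable (by norm_num)
  have hw' : Differentiable ℝ w := hw.differentiable (by norm_num)
  have hau := differentiable_advection hu hv hw hu
  have hav := differentiable_advection hu hv hw hv
  have haw := differentiable_advection hu hv hw hw
  have hX : Differentiable ℝ (pX P) := hP.differentiable_dirDeriv _
  have hY : Differentiable ℝ (pY P) := hP.differentiable_dirDeriv _
  have hZ : Differentiable ℝ (pZ P) := hP.differentiable_dirDeriv _
  have d1 (e : ℝ × ℝ × ℝ × ℝ) := congrArg (fun F => dirDeriv e F p)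
    (funext fun p => (heq1 p).trans (by ring : _ = (-1 / ρ) * pX P p))
  have d2 (e : ℝ × ℝ × ℝ × ℝ) := congrArg (fun F => dirDeriv e F p)
    (funext fun p => (heq2 p).trans (by ring : _ = (-1 / ρ) * pY P p))
  have d3 (e : ℝ × ℝ × ℝ × ℝ) := congrArg (fun F => dirDeriv e F p)
    (funext fun p => (heq3 p).trans (by ring : _ = (-1 / ρ) * pZ P p))
  simp (disch := fun_prop) only [dirDeriv_add _ _ hau, dirDeriv_add _ _ hav, dirDeriv_sub,
    dirDeriv_mul, dirDeriv_const, dirDeriv_y, dirDeriv_advection hu hv hw hu,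
    dirDeriv_advection hu hv hw hv, dirDeriv_advection hu hv hw hw] at d1 d2 d3
  have c1 := dirDeriv_constraint_sub hw hv hvort1
  have c2 := dirDeriv_constraint_sub hu hw hvort2
  have c3 := dirDeriv_constraint_sub hv hu hvort3
  have m := hmass p
  have r1 := hvort1 p
  have r2 := hvort2 p
  have r3 := hvort3 p
  have d1y := d1 (0, 1, 0, 0)
  have d1z := d1 (0, 0, 1, 0)
  have d2x := d2 (1, 0, 0, 0)
  have d2z := d2 (0, 0, 1, 0)
  have d3x := d3 (1, 0, 0, 0)
  have d3y := d3 (0, 1, 0, 0)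
  simp only [pX_eq_dirDeriv, pY_eq_dirDeriv, pZ_eq_dirDeriv, pT_eq_dirDeriv] at *
  have sxy := dirDeriv_comm (1, 0, 0, 0) (0, 1, 0, 0) p hP
  have sxz := dirDeriv_comm (1, 0, 0, 0) (0, 0, 1, 0) p hP
  have syz := dirDeriv_comm (0, 1, 0, 0) (0, 0, 1, 0) p hP
  rw [c1] at d3y
  rw [c2] at d1z
  rw [c3] at d2x
  simp only [c1, c2, c3] at d1y d1z d2x d2z d3x d3y
  have n : -1 / ρ = -(1 / ρ) := by ring
  simp only [n] at d1y d1z d2x d2z d3x d3y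
  subst r1 r2 r3
  refine ⟨?_, ?_, ?_⟩
  · linear_combination d2z - d3y + (1 / ρ) * syz
      + (dirDeriv (0, 1, 0, 0) w p - dirDeriv (0, 0, 1, 0) v p) * m
  · linear_combination d3x - d1z - (1 / ρ) * sxz
      + (dirDeriv (0, 0, 1, 0) u p - dirDeriv (1, 0, 0, 0) w p + 2 * Ω) * m
  · linear_combination d1y - d2x + (1 / ρ) * sxy
      + (dirDeriv (1, 0, 0, 0) v p - dirDeriv (0, 1, 0, 0) u p + β * p.2.1) * m

end Vorticity

/-- Laplace's equation for the meridional and vertical velocities of a solenoidal field with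
constant vorticity. -/
theorem laplacian_eq_zero {u v w : ℝ × ℝ × ℝ × ℝ → ℝ} {Λ₁ Λ₂ Λ₃ : ℝ} (hu : ContDiff ℝ 2 u)
    (hv : ContDiff ℝ 2 v) (hw : ContDiff ℝ 2 w)
    (hmass : ∀ p, pX u p + pY v p + pZ w p = 0)
    (hvort1 : ∀ p, pY w p - pZ v p = Λ₁)
    (hvort2 : ∀ p, pZ u p - pX w p = Λ₂)
    (hvort3 : ∀ p, pX v p - pY u p = Λ₃) (p : ℝ × ℝ × ℝ × ℝ) :
    pX (pX v) p + pY (pY v) p + pZ (pZ v) p = 0 ∧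
      pX (pX w) p + pY (pY w) p + pZ (pZ w) p = 0 := by
  have c1 := dirDeriv_constraint_sub hw hv hvort1
  have c2 := dirDeriv_constraint_sub hu hw hvort2
  have c3 := dirDeriv_constraint_sub hv hu hvort3
  have my := dirDeriv_mass hu hv hw hmass (0, 1, 0, 0) p
  have mz := dirDeriv_mass hu hv hw hmass (0, 0, 1, 0) p
  have sxy := dirDeriv_comm (1, 0, 0, 0) (0, 1, 0, 0) p hu
  have sxz := dirDeriv_comm (1, 0, 0, 0) (0, 0, 1, 0) p hu
  have syz := dirDeriv_comm (0, 1, 0, 0) (0, 0, 1, 0) p hw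
  have syz' := dirDeriv_comm (0, 1, 0, 0) (0, 0, 1, 0) p hv
  simp only [pX_eq_dirDeriv, pY_eq_dirDeriv, pZ_eq_dirDeriv] at *
  constructor
  · linear_combination my + c3 (1, 0, 0, 0) p + sxy - c1 (0, 0, 1, 0) p - syz
  · linear_combination mz - c2 (1, 0, 0, 0) p + sxz + c1 (0, 1, 0, 0) p + syz'

/-- A solenoidal flow with constant vorticity over a flat bed that satisfies the vorticity
equation of the `β`-plane has no meridional and no vertical velocity. -/
theorem meridional_vertical_eq_zero {u v w : ℝ × ℝ × ℝ × ℝ → ℝ} {Λ₁ Λ₂ Λ₃ a β d : ℝ}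
    (ha : a ≠ 0) (hβ : β ≠ 0)
    (hu : ContDiff ℝ 2 u) (hv : ContDiff ℝ 2 v) (hw : ContDiff ℝ 2 w)
    (hmass : ∀ p, pX u p + pY v p + pZ w p = 0)
    (hvort1 : ∀ p, pY w p - pZ v p = Λ₁)
    (hvort2 : ∀ p, pZ u p - pX w p = Λ₂)
    (hvort3 : ∀ p, pX v p - pY u p = Λ₃)
    (hDv : ∀ p, Λ₁ * pX v p + a * pY v p + (Λ₃ + β * p.2.1) * pZ v p = 0)
    (hDw : ∀ p, Λ₁ * pX w p + a * pY w p + (Λ₃ + β * p.2.1) * pZ w p = β * v p)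
    (hbot : ∀ x y t : ℝ, w (x, y, -d, t) = 0) :
    (∀ p, v p = 0) ∧ ∀ p, w p = 0 := by
  obtain ⟨k, hk⟩ : ∃ k, Λ₁ = a * k := ⟨Λ₁ / a, by field_simp⟩
  obtain ⟨m, hm⟩ : ∃ m, Λ₃ = a * m := ⟨Λ₃ / a, by field_simp⟩
  obtain ⟨b, hb⟩ : ∃ b, β = a * b := ⟨β / a, by field_simp⟩
  have hb0 : b ≠ 0 := by rintro rfl; simp_all
  have hΔ := laplacian_eq_zero hu hv hw hmass hvort1 hvort2 hvort3
  subst hk hm hb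
  have hv' : Differentiable ℝ v := hv.differentiable (by norm_num)
  have hw' : Differentiable ℝ w := hw.differentiable (by norm_num)
  have hvd := fun e => hv.differentiable_dirDeriv e
  have hwd := fun e => hw.differentiable_dirDeriv e
  set q : ℝ × ℝ × ℝ × ℝ → ℝ := fun p => w p - b * p.2.1 * v p with hq_def
  have hq : ContDiff ℝ 2 q := by fun_prop
  have hqe (e p : ℝ × ℝ × ℝ × ℝ) :
      dirDeriv e q p = dirDeriv e w p - (b * p.2.1 * dirDeriv e v p + b * e.2.1 * v p) := by
    rw [hq_def]
    simp (disch := fun_prop) only [dirDeriv_sub, dirDeriv_mul, dirDeriv_const, dirDeriv_y]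
    ring
  have hqee (e p : ℝ × ℝ × ℝ × ℝ) :
      dirDeriv e (dirDeriv e q) p = dirDeriv e (dirDeriv e w) p
        - (b * p.2.1 * dirDeriv e (dirDeriv e v) p + 2 * b * e.2.1 * dirDeriv e v p) := by
    rw [funext (hqe e)]
    simp (disch := fun_prop) only [dirDeriv_add, dirDeriv_sub, dirDeriv_mul, dirDeriv_const,
      dirDeriv_y]
    ring
  have tv (p) : k * pX v p + pY v p + (m + b * p.2.1) * pZ v p = 0 :=
    mul_left_cancel₀ ha (by linear_combination hDv p)
  have tw (p) : k * pX w p + pY w p + (m + b * p.2.1) * pZ w p = b * v p :=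
    mul_left_cancel₀ ha (by linear_combination hDw p)
  have tq (p) : k * pX q p + pY q p + (m + b * p.2.1) * pZ q p = 0 := by
    have h1 := tv p
    have h2 := tw p
    simp only [pX_eq_dirDeriv, pY_eq_dirDeriv, pZ_eq_dirDeriv, hqe] at *
    linear_combination h2 - b * p.2.1 * h1
  have hφ (y : ℝ) : HasDerivAt (fun y => m * y + b / 2 * y ^ 2) (m + b * y) y := by
    refine (((hasDerivAt_id y).const_mul m).add
      (((hasDerivAt_id y).pow 2).const_mul (b / 2))).congr_deriv ?_
    simp only [id]
    ring
  have hvs := ShearInvariant.of_transport hv' hφ (by simp) tv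
  have hqs := ShearInvariant.of_transport (hq.differentiable (by norm_num)) hφ (by simp) tq
  have hvzz := pZ_pZ_eq_zero_of_transport (A := 0) (B := 0) hb0 hv tv hvs
    (fun _ _ _ _ => rfl) (fun _ _ _ _ => rfl) (fun p => by simpa using (hΔ p).1)
  have hqzz := pZ_pZ_eq_zero_of_transport
    (A := fun p => 2 * b * (k * pX v p + m * pZ v p)) (B := fun p => 2 * b ^ 2 * pZ v p)
    hb0 hq tq hqs
    (fun x y z t => by simp only [(hvs.pX hv') x y z t, (hvs.pZ hv') x y z t])
    (fun x y z t => by simp only [(hvs.pZ hv') x y z t])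
    (fun p => by
      have h1 := tv p
      have h2 := hΔ p
      simp only [pX_eq_dirDeriv, pY_eq_dirDeriv, pZ_eq_dirDeriv, hqee] at *
      linear_combination h2.2 - b * p.2.1 * h2.1 - 2 * b * h1)
  obtain ⟨hv0, hq0⟩ := eq_zero_of_bottom (d := d) hb0 hv hq hvs hqs hvzz hqzz
    (fun x y t => by simp [hq_def, hbot])
  exact ⟨hv0, fun p => by simpa [hq_def, hv0] using hq0 p⟩

theorem eq_zero_of_abs_mul_le {c M : ℝ} (h : ∀ y : ℝ, |y * c| ≤ M) : c = 0 := by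
  by_contra hc
  have h1 := h ((M + 1) / c)
  rw [div_mul_cancel₀ _ hc] at h1
  linarith [le_abs_self (M + 1)]

/-- Theorem 1 (transformed form): a constant-vorticity solution of the transformed β-plane
system over a flat bed, whose physical pressure has bounded `y`-variation along the free
surface, is the uniform zonal flow `u₁ ≡ Ω²/β`, `v₁ ≡ 0`, `w₁ ≡ 0` with hydrostatic
pressure `P₁ = ρ₁[(2Ω³/β − Ω²R + g)z + c₁(t)]`. -/
theorem theorem1_transformed (Ω R g d β ρ₁ : ℝ) (hβ : 0 < β) (hρ : 0 < ρ₁)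
    (Λ₁ Λ₂ Λ₃ : ℝ) (hΩ : Λ₂ + 2 * Ω ≠ 0)
    (u₁ v₁ w₁ Ptil₁ P₁ : ℝ × ℝ × ℝ × ℝ → ℝ)
    (hu : ContDiff ℝ 2 u₁) (hv : ContDiff ℝ 2 v₁) (hw : ContDiff ℝ 2 w₁)
    (hPtil : ContDiff ℝ 2 Ptil₁)
    (heq1 : ∀ p : ℝ × ℝ × ℝ × ℝ,
      pT u₁ p + u₁ p * pX u₁ p + v₁ p * pY u₁ p + w₁ p * pZ u₁ p + 2 * Ω * w₁ p
        - β * p.2.1 * v₁ p = -(pX Ptil₁ p) / ρ₁)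
    (heq2 : ∀ p : ℝ × ℝ × ℝ × ℝ,
      pT v₁ p + u₁ p * pX v₁ p + v₁ p * pY v₁ p + w₁ p * pZ v₁ p + β * p.2.1 * u₁ p
        = -(pY Ptil₁ p) / ρ₁)
    (heq3 : ∀ p : ℝ × ℝ × ℝ × ℝ,
      pT w₁ p + u₁ p * pX w₁ p + v₁ p * pY w₁ p + w₁ p * pZ w₁ p - 2 * Ω * u₁ p
        = -(pZ Ptil₁ p) / ρ₁)
    (hmass : ∀ p : ℝ × ℝ × ℝ × ℝ, pX u₁ p + pY v₁ p + pZ w₁ p = 0)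
    (hvort1 : ∀ p : ℝ × ℝ × ℝ × ℝ, pY w₁ p - pZ v₁ p = Λ₁)
    (hvort2 : ∀ p : ℝ × ℝ × ℝ × ℝ, pZ u₁ p - pX w₁ p = Λ₂)
    (hvort3 : ∀ p : ℝ × ℝ × ℝ × ℝ, pX v₁ p - pY u₁ p = Λ₃)
    (hbot : ∀ x y t : ℝ, w₁ (x, y, -d, t) = 0)
    (hPdef : ∀ p : ℝ × ℝ × ℝ × ℝ,
      P₁ p = Ptil₁ p + ρ₁ * Ω ^ 2 * p.2.1 ^ 2 / 2 - ρ₁ * (Ω ^ 2 * R - g) * p.2.2.1)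
    (η₁ : ℝ × ℝ × ℝ → ℝ) (hη : Differentiable ℝ η₁)
    (hηy : ∃ M : ℝ, ∀ q : ℝ × ℝ × ℝ, |sY η₁ q| ≤ M)
    (hbound : ∀ x t : ℝ, ∃ M : ℝ, ∀ y : ℝ,
      |pY P₁ (x, y, η₁ (x, y, t), t)
        + pZ P₁ (x, y, η₁ (x, y, t), t) * sY η₁ (x, y, t)| ≤ M) :
    (∀ p : ℝ × ℝ × ℝ × ℝ, u₁ p = Ω ^ 2 / β) ∧
    (∀ p : ℝ × ℝ × ℝ × ℝ, v₁ p = 0) ∧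
    (∀ p : ℝ × ℝ × ℝ × ℝ, w₁ p = 0) ∧
    ∃ c₁ : ℝ → ℝ, ∀ p : ℝ × ℝ × ℝ × ℝ,
      P₁ p = ρ₁ * ((2 * Ω ^ 3 / β - Ω ^ 2 * R + g) * p.2.2.1 + c₁ p.2.2.2) := by
  have hD := vorticity_equation hu hv hw hPtil heq1 heq2 heq3 hmass hvort1 hvort2 hvort3
  obtain ⟨hv0, hw0⟩ := meridional_vertical_eq_zero hΩ hβ.ne' hu hv hw hmass hvort1 hvort2
    hvort3 (fun p => (hD p).2.1) (fun p => (hD p).2.2) hbot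
  obtain rfl : v₁ = fun _ => 0 := funext hv0
  obtain rfl : w₁ = fun _ => 0 := funext hw0
  have hu' : Differentiable ℝ u₁ := hu.differentiable (by norm_num)
  have hP' : Differentiable ℝ Ptil₁ := hPtil.differentiable (by norm_num)
  have hzero (e p : ℝ × ℝ × ℝ × ℝ) : fderiv ℝ (fun _ : ℝ × ℝ × ℝ × ℝ => (0 : ℝ)) p e = 0 := by
    simp
  simp only [pX, pY, pZ, hzero] at hmass hvort1 hvort2 hvort3 hD
  simp only [← pX.eq_1, ← pY.eq_1, ← pZ.eq_1] at hmass hvort1 hvort2 hvort3 hD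
  have hux (p) : pX u₁ p = 0 := by linarith [hmass p]
  have huz' (p) : pZ u₁ p = Λ₂ := by linarith [hvort2 p]
  have huy' (p) : pY u₁ p = -Λ₃ := by linarith [hvort3 p]
  have e0 := (hD (0, 0, 0, 0)).1
  have e1 := (hD (0, 1, 0, 0)).1
  simp only [hux, huz', huy'] at e0 e1
  have hΛ₂ : Λ₂ = 0 := by
    have : β * Λ₂ = 0 := by linear_combination e1 - e0
    simpa [hβ.ne'] using this
  subst hΛ₂
  have hΛ₃ : Λ₃ = 0 := by
    have : (0 + 2 * Ω) * Λ₃ = 0 := by linear_combination -e0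
    exact (mul_eq_zero.mp this).resolve_left hΩ
  subst hΛ₃
  have hut := eq_at_origin_of_grad_eq_zero hu' hux (by simpa using huy') huz'
  obtain rfl : P₁ = fun p => Ptil₁ p + ρ₁ * Ω ^ 2 / 2 * (p.2.1 * p.2.1)
      - ρ₁ * (Ω ^ 2 * R - g) * p.2.2.1 := funext fun p => by rw [hPdef p]; ring
  have hPe (e p : ℝ × ℝ × ℝ × ℝ) :
      dirDeriv e (fun p => Ptil₁ p + ρ₁ * Ω ^ 2 / 2 * (p.2.1 * p.2.1)
        - ρ₁ * (Ω ^ 2 * R - g) * p.2.2.1) p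
      = dirDeriv e Ptil₁ p + ρ₁ * Ω ^ 2 * p.2.1 * e.2.1 - ρ₁ * (Ω ^ 2 * R - g) * e.2.2.1 := by
    simp (disch := fun_prop) only [dirDeriv_add, dirDeriv_sub, dirDeriv_mul, dirDeriv_const,
      dirDeriv_y, dirDeriv_z]
    ring
  have gy (p : ℝ × ℝ × ℝ × ℝ) : pY Ptil₁ p = -ρ₁ * β * p.2.1 * u₁ p := by
    have h := heq2 p
    simp only [pX, pY, pZ, pT, hzero] at h
    rw [eq_div_iff hρ.ne'] at h
    simp only [pY]
    linear_combination h
  have gz (p : ℝ × ℝ × ℝ × ℝ) : pZ Ptil₁ p = ρ₁ * (2 * Ω) * u₁ p := by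
    have h := heq3 p
    simp only [pX, pY, pZ, pT, hzero] at h
    rw [eq_div_iff hρ.ne'] at h
    simp only [pZ]
    linear_combination h
  have hut0 (t : ℝ) : Ω ^ 2 - β * u₁ (0, 0, 0, t) = 0 := by
    obtain ⟨N, hN⟩ := hηy
    obtain ⟨M, hM⟩ := hbound 0 t
    set c := ρ₁ * (2 * Ω) * u₁ (0, 0, 0, t) - ρ₁ * (Ω ^ 2 * R - g) with hc
    have : ρ₁ * (Ω ^ 2 - β * u₁ (0, 0, 0, t)) = 0 := by
      refine eq_zero_of_abs_mul_le (M := M + |c| * N) fun y => ?_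
      have h1 := hM y
      rw [pY_eq_dirDeriv, pZ_eq_dirDeriv, hPe, hPe, ← pY_eq_dirDeriv, ← pZ_eq_dirDeriv, gy, gz,
        hut] at h1
      have h2 : |c * sY η₁ (0, y, t)| ≤ |c| * N := by
        rw [abs_mul]
        exact mul_le_mul_of_nonneg_left (hN _) (abs_nonneg c)
      have h3 := abs_sub _ _ |>.trans (add_le_add h1 h2)
      refine le_trans (le_of_eq ?_) h3
      rw [hc]
      congr 1
      ring
    exact (mul_eq_zero.mp this).resolve_left hρ.ne'
  have hconst (p : ℝ × ℝ × ℝ × ℝ) : u₁ p = Ω ^ 2 / β := by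
    obtain ⟨x, y, z, t⟩ := p
    rw [hut, eq_div_iff hβ.ne']
    linear_combination -hut0 t
  have gx (p : ℝ × ℝ × ℝ × ℝ) : pX Ptil₁ p = 0 := by
    have h := heq1 p
    rw [funext hconst] at h
    simp only [pX, pY, pZ, pT, fderiv_fun_const, Pi.zero_apply,
      zero_apply] at h
    rw [eq_div_iff hρ.ne'] at h
    simp only [pX]
    linear_combination h
  refine ⟨hconst, fun _ => rfl, fun _ => rfl, fun t => Ptil₁ (0, 0, 0, t) / ρ₁, ?_⟩
  set Q : ℝ × ℝ × ℝ × ℝ → ℝ := fun p => Ptil₁ p + ρ₁ * Ω ^ 2 / 2 * (p.2.1 * p.2.1)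
      - ρ₁ * (2 * Ω ^ 3 / β) * p.2.2.1 with hQ
  have hQd : Differentiable ℝ Q := by fun_prop
  have hQe (e p : ℝ × ℝ × ℝ × ℝ) :
      dirDeriv e Q p
      = dirDeriv e Ptil₁ p + ρ₁ * Ω ^ 2 * p.2.1 * e.2.1 - ρ₁ * (2 * Ω ^ 3 / β) * e.2.2.1 := by
    rw [hQ]
    simp (disch := fun_prop) only [dirDeriv_add, dirDeriv_sub, dirDeriv_mul, dirDeriv_const,
      dirDeriv_y, dirDeriv_z]
    ring
  have hQc := eq_at_origin_of_grad_eq_zero hQd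
    (fun p => by rw [pX_eq_dirDeriv, hQe, ← pX_eq_dirDeriv, gx]; ring)
    (fun p => by rw [pY_eq_dirDeriv, hQe, ← pY_eq_dirDeriv, gy, hconst]; field_simp; ring)
    (fun p => by rw [pZ_eq_dirDeriv, hQe, ← pZ_eq_dirDeriv, gz, hconst]; field_simp; ring)
  rintro ⟨x, y, z, t⟩
  have h := hQc x y z t
  simp only [hQ] at h
  have h' : ρ₁ * (Ptil₁ (0, 0, 0, t) / ρ₁) = Ptil₁ (0, 0, 0, t) := mul_div_cancel₀ _ hρ.ne'
  simp only
  linear_combination h - h'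
end

section
/- (Theorem 2, two-layer flow.) Let Ω, R, g, d, z₀, P_atm be real constants, β > 0, ρ₁, ρ₂ > 0, and set k = 2Ω³/β − Ω² R + g. For i = 1, 2, suppose uᵢ, vᵢ, wᵢ : ℝ⁴ → ℝ are C² and P̃ᵢ : ℝ⁴ → ℝ is C², satisfying the transformed β-plane system u_t + u u_x + v u_y + w u_z + 2Ω w − β y v = −P̃_x/ρᵢ, v_t + u v_x + v v_y + w v_z + β y u = −P̃_y/ρᵢ, w_t + u w_x + v w_y + w w_z − 2Ω u = −P̃_z/ρᵢ, together with mass conservation u_x + v_y + w_z = 0 and constant vorticity (w_y − v_z, u_z − w_x, v_x − u_y) = (Λ₁⁽ⁱ⁾, Λ₂⁽ⁱ⁾, Λ₃⁽ⁱ⁾) with Λ₂⁽ⁱ⁾ + 2Ω ≠ 0; assume w₁(x,y,−d,t) = 0 and w₂(x,y,z₀,t) = 0 for all x,y,t. Define Pᵢ = P̃ᵢ + ρᵢ Ω² y²/2 − ρᵢ (Ω² R − g) z. Let η₁, η₂ : ℝ³ → ℝ be differentiable with |∂_y η₁|, |∂_y η₂| bounded, and assume for i = 1, 2 and each fixed (x,t)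 that y ↦ (Pᵢ)_y + (Pᵢ)_z · ∂_y ηᵢ evaluated at z = ηᵢ(x,y,t) is bounded on ℝ. Assume the interface continuity condition P₁(x, y, η₁(x,y,t), t) = P₂(x, y, η₁(x,y,t), t) and the free-surface condition P₂(x, y, η₂(x,y,t), t) = P_atm for all x, y, t. Then P₂(x,y,z,t) = ρ₂ k (z − η₂(x,y,t)) + P_atm and P₁(x,y,z,t) = ρ₁ k z + (ρ₂ − ρ₁) k η₁(x,y,t) − ρ₂ k η₂(x,y,t) + P_atm for all (x,y,z,t). -/
theorem ContDiff.differentiable_fderiv_dir {f : ℝ × ℝ × ℝ × ℝ → ℝ} (hf : ContDiff ℝ 2 f)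
    (e : ℝ × ℝ × ℝ × ℝ) : Differentiable ℝ (fun q => fderiv ℝ f q e) :=
  ((hf.fderiv_right (m := 1) (by norm_num)).differentiable one_ne_zero).clm_apply
    (differentiable_const e)

theorem ContDiff.fderiv_dir_comm {f : ℝ × ℝ × ℝ × ℝ → ℝ} (hf : ContDiff ℝ 2 f)
    (p e e' : ℝ × ℝ × ℝ × ℝ) :
    fderiv ℝ (fun q => fderiv ℝ f q e) p e' = fderiv ℝ (fun q => fderiv ℝ f q e') p e := by
  have hd : DifferentiableAt ℝ (fderiv ℝ f) p :=
    (hf.fderiv_right (m := 1) (by norm_num)).differentiable one_ne_zero p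
  have hs : IsSymmSndFDerivAt ℝ f p := hf.contDiffAt.isSymmSndFDerivAt (by simp)
  rw [fderiv_clm_apply hd (differentiableAt_const e),
    fderiv_clm_apply hd (differentiableAt_const e')]
  simpa using hs.eq e' e

theorem fderiv_eq_of_sub_eq_const {a b : ℝ × ℝ × ℝ × ℝ → ℝ} (ha : Differentiable ℝ a)
    (hb : Differentiable ℝ b) {c : ℝ} (h : ∀ q, a q - b q = c) (p : ℝ × ℝ × ℝ × ℝ) :
    fderiv ℝ a p = fderiv ℝ b p := by
  have h1 := ((ha p).hasFDerivAt.sub (hb p).hasFDerivAt).fderiv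
  have h2 : a - b = fun _ => c := funext h
  rw [h2, fderiv_fun_const] at h1
  exact (sub_eq_zero.mp h1.symm)

theorem hasFDerivAt_coord_y (p : ℝ × ℝ × ℝ × ℝ) :
    HasFDerivAt (fun q : ℝ × ℝ × ℝ × ℝ => q.2.1)
      ((ContinuousLinearMap.fst ℝ ℝ (ℝ × ℝ)).comp (ContinuousLinearMap.snd ℝ ℝ (ℝ × ℝ × ℝ))) p :=
  ((ContinuousLinearMap.fst ℝ ℝ (ℝ × ℝ)).comp
    (ContinuousLinearMap.snd ℝ ℝ (ℝ × ℝ × ℝ))).hasFDerivAt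

theorem fderiv_apply_eq (f : ℝ × ℝ × ℝ × ℝ → ℝ) (p : ℝ × ℝ × ℝ × ℝ) (a b c d : ℝ) :
    fderiv ℝ f p (a, b, c, d) = a * pX f p + b * pY f p + c * pZ f p + d * pT f p := by
  have : ((a, b, c, d) : ℝ × ℝ × ℝ × ℝ) = a • (1, 0, 0, 0) + b • (0, 1, 0, 0)
      + c • (0, 0, 1, 0) + d • (0, 0, 0, 1) := by simp
  rw [this]
  simp only [map_add, map_smul, smul_eq_mul, pX, pY, pZ, pT]

/-- A component of the momentum equation, differentiated in the direction `e`. -/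
theorem fderiv_momentum {a b b' u v w G : ℝ × ℝ × ℝ × ℝ → ℝ} {α γ ρ : ℝ}
    (ha : ContDiff ℝ 2 a) (hb : Differentiable ℝ b) (hb' : Differentiable ℝ b')
    (hu : Differentiable ℝ u) (hv : Differentiable ℝ v) (hw : Differentiable ℝ w)
    (hG : Differentiable ℝ G)
    (h : ∀ q, pT a q + u q * pX a q + v q * pY a q + w q * pZ a q
      + (α * b q + γ * (q.2.1 * b' q)) = -(G q) / ρ) (p e : ℝ × ℝ × ℝ × ℝ) :
    pT (fun q => fderiv ℝ a q e) p
      + (u p * pX (fun q => fderiv ℝ a q e) p + pX a p * fderiv ℝ u p e)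
      + (v p * pY (fun q => fderiv ℝ a q e) p + pY a p * fderiv ℝ v p e)
      + (w p * pZ (fun q => fderiv ℝ a q e) p + pZ a p * fderiv ℝ w p e)
      + (α * fderiv ℝ b p e + γ * (p.2.1 * fderiv ℝ b' p e + b' p * e.2.1))
      = -(fderiv ℝ G p e) / ρ := by
  have hd := fun e' => (ha.differentiable_fderiv_dir e' p).hasFDerivAt
  have hL := (((((hd (0, 0, 0, 1)).add ((hu p).hasFDerivAt.mul (hd (1, 0, 0, 0)))).add
    ((hv p).hasFDerivAt.mul (hd (0, 1, 0, 0)))).add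
    ((hw p).hasFDerivAt.mul (hd (0, 0, 1, 0)))).add
    (((hb p).hasFDerivAt.const_mul α).add
      (((hasFDerivAt_coord_y p).mul (hb' p).hasFDerivAt).const_mul γ)))
  have hR := ((hG p).hasFDerivAt.neg).mul_const (ρ⁻¹)
  have := congrArg (fun L => L e) (hL.unique (hR.congr_of_eventuallyEq
    (Filter.Eventually.of_forall fun q => by
      have := h q
      simp only [pT, pX, pY, pZ] at this
      simpa [div_eq_mul_inv] using this)))
  simp only [pT, pX, pY, pZ, ha.fderiv_dir_comm p e]
  simp at this
  rw [neg_div, div_eq_inv_mul, mul_add γ]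
  exact this

/-- A flow of the transformed β-plane system of constant density and constant vorticity. -/
structure IsBetaPlaneFlow (Ω β ρ Λ₁ Λ₂ Λ₃ : ℝ) (u v w P : ℝ × ℝ × ℝ × ℝ → ℝ) : Prop where
  contDiff_u : ContDiff ℝ 2 u
  contDiff_v : ContDiff ℝ 2 v
  contDiff_w : ContDiff ℝ 2 w
  contDiff_P : ContDiff ℝ 2 P
  momentum_x : ∀ p, pT u p + u p * pX u p + v p * pY u p + w p * pZ u p + 2 * Ω * w p
    - β * p.2.1 * v p = -(pX P p) / ρ
  momentum_y : ∀ p, pT v p + u p * pX v p + v p * pY v p + w p * pZ v p + β * p.2.1 * u p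
    = -(pY P p) / ρ
  momentum_z : ∀ p, pT w p + u p * pX w p + v p * pY w p + w p * pZ w p - 2 * Ω * u p
    = -(pZ P p) / ρ
  mass : ∀ p, pX u p + pY v p + pZ w p = 0
  vort_x : ∀ p, pY w p - pZ v p = Λ₁
  vort_y : ∀ p, pZ u p - pX w p = Λ₂
  vort_z : ∀ p, pX v p - pY u p = Λ₃

namespace IsBetaPlaneFlow

variable {Ω β ρ Λ₁ Λ₂ Λ₃ : ℝ} {u v w P : ℝ × ℝ × ℝ × ℝ → ℝ}

theorem fderiv_vort_x (h : IsBetaPlaneFlow Ω β ρ Λ₁ Λ₂ Λ₃ u v w P) (p : ℝ × ℝ × ℝ × ℝ) :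
    fderiv ℝ (pY w) p = fderiv ℝ (pZ v) p :=
  fderiv_eq_of_sub_eq_const (h.contDiff_w.differentiable_fderiv_dir _)
    (h.contDiff_v.differentiable_fderiv_dir _) h.vort_x p

theorem fderiv_vort_y (h : IsBetaPlaneFlow Ω β ρ Λ₁ Λ₂ Λ₃ u v w P) (p : ℝ × ℝ × ℝ × ℝ) :
    fderiv ℝ (pZ u) p = fderiv ℝ (pX w) p :=
  fderiv_eq_of_sub_eq_const (h.contDiff_u.differentiable_fderiv_dir _)
    (h.contDiff_w.differentiable_fderiv_dir _) h.vort_y p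

theorem fderiv_vort_z (h : IsBetaPlaneFlow Ω β ρ Λ₁ Λ₂ Λ₃ u v w P) (p : ℝ × ℝ × ℝ × ℝ) :
    fderiv ℝ (pX v) p = fderiv ℝ (pY u) p :=
  fderiv_eq_of_sub_eq_const (h.contDiff_v.differentiable_fderiv_dir _)
    (h.contDiff_u.differentiable_fderiv_dir _) h.vort_z p

theorem fderiv_mass (h : IsBetaPlaneFlow Ω β ρ Λ₁ Λ₂ Λ₃ u v w P) (p e : ℝ × ℝ × ℝ × ℝ) :
    fderiv ℝ (pX u) p e + fderiv ℝ (pY v) p e + fderiv ℝ (pZ w) p e = 0 := by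
  have hL := (((h.contDiff_u.differentiable_fderiv_dir (1, 0, 0, 0) p).hasFDerivAt.add
    (h.contDiff_v.differentiable_fderiv_dir (0, 1, 0, 0) p).hasFDerivAt).add
    (h.contDiff_w.differentiable_fderiv_dir (0, 0, 1, 0) p).hasFDerivAt)
  exact congrArg (fun L => L e) (hL.unique ((hasFDerivAt_const (0 : ℝ) p).congr_of_eventuallyEq
    (Filter.Eventually.of_forall h.mass)))

theorem vorticity_equations (h : IsBetaPlaneFlow Ω β ρ Λ₁ Λ₂ Λ₃ u v w P) (p : ℝ × ℝ × ℝ × ℝ) :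
    Λ₁ * pX u p + (Λ₂ + 2 * Ω) * pY u p + (Λ₃ + β * p.2.1) * pZ u p = 0 ∧
    Λ₁ * pX v p + (Λ₂ + 2 * Ω) * pY v p + (Λ₃ + β * p.2.1) * pZ v p = 0 ∧
    Λ₁ * pX w p + (Λ₂ + 2 * Ω) * pY w p + (Λ₃ + β * p.2.1) * pZ w p = β * v p := by
  have du := h.contDiff_u.differentiable two_ne_zero
  have dv := h.contDiff_v.differentiable two_ne_zero
  have dw := h.contDiff_w.differentiable two_ne_zero
  have dP := h.contDiff_P.differentiable_fderiv_dir
  have ex := fderiv_momentum (α := 2 * Ω) (γ := -β) (ρ := ρ) (G := pX P) h.contDiff_u dw dv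
    du dv dw (dP _) (fun q => by rw [← h.momentum_x q]; ring) p
  have ey := fderiv_momentum (α := 0) (γ := β) (ρ := ρ) (G := pY P) h.contDiff_v du du
    du dv dw (dP _) (fun q => by rw [← h.momentum_y q]; ring) p
  have ez := fderiv_momentum (α := -(2 * Ω)) (γ := 0) (ρ := ρ) (G := pZ P) h.contDiff_w du du
    du dv dw (dP _) (fun q => by rw [← h.momentum_z q]; ring) p
  have exy := ex (0, 1, 0, 0)
  have exz := ex (0, 0, 1, 0)
  have eyx := ey (1, 0, 0, 0)
  have eyz := ey (0, 0, 1, 0)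
  have ezx := ez (1, 0, 0, 0)
  have ezy := ez (0, 1, 0, 0)
  have cxy : fderiv ℝ (pX P) p (0, 1, 0, 0) = fderiv ℝ (pY P) p (1, 0, 0, 0) :=
    h.contDiff_P.fderiv_dir_comm p _ _
  have cxz : fderiv ℝ (pX P) p (0, 0, 1, 0) = fderiv ℝ (pZ P) p (1, 0, 0, 0) :=
    h.contDiff_P.fderiv_dir_comm p _ _
  have cyz : fderiv ℝ (pY P) p (0, 0, 1, 0) = fderiv ℝ (pZ P) p (0, 1, 0, 0) :=
    h.contDiff_P.fderiv_dir_comm p _ _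
  have vx : fderiv ℝ (fun q => fderiv ℝ w q (0, 1, 0, 0)) p
      = fderiv ℝ (fun q => fderiv ℝ v q (0, 0, 1, 0)) p := h.fderiv_vort_x p
  have vy : fderiv ℝ (fun q => fderiv ℝ u q (0, 0, 1, 0)) p
      = fderiv ℝ (fun q => fderiv ℝ w q (1, 0, 0, 0)) p := h.fderiv_vort_y p
  have vz : fderiv ℝ (fun q => fderiv ℝ v q (1, 0, 0, 0)) p
      = fderiv ℝ (fun q => fderiv ℝ u q (0, 1, 0, 0)) p := h.fderiv_vort_z p
  have v1 := h.vort_x p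
  have v2 := h.vort_y p
  have v3 := h.vort_z p
  have m := h.mass p
  rw [cxy] at exy
  rw [cxz] at exz
  rw [cyz] at eyz
  simp only [pX, pY, pZ, pT] at exy exz eyx eyz ezx ezy v1 v2 v3 m ⊢
  rw [← vz] at exy
  rw [vy] at exz
  rw [← vx] at eyz
  refine ⟨?_, ?_, ?_⟩
  · rw [← v1, ← v2, ← v3]
    linear_combination eyz - ezy + (fderiv ℝ w p (0, 1, 0, 0) - fderiv ℝ v p (0, 0, 1, 0)) * m
  · rw [← v1, ← v2, ← v3]
    linear_combination ezx - exz
      + (fderiv ℝ u p (0, 0, 1, 0) - fderiv ℝ w p (1, 0, 0, 0) + 2 * Ω) * m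
  · rw [← v1, ← v2, ← v3]
    linear_combination exy - eyx
      + (fderiv ℝ v p (1, 0, 0, 0) - fderiv ℝ u p (0, 1, 0, 0) + β * p.2.1) * m

end IsBetaPlaneFlow

theorem hasDerivAt_x {f : ℝ × ℝ × ℝ × ℝ → ℝ} (hf : Differentiable ℝ f) (x y z t : ℝ) :
    HasDerivAt (fun s => f (s, y, z, t)) (pX f (x, y, z, t)) x :=
  (hf (x, y, z, t)).hasFDerivAt.comp_hasDerivAt x
    ((hasDerivAt_id x).prodMk ((hasDerivAt_const x y).prodMk
      ((hasDerivAt_const x z).prodMk (hasDerivAt_const x t))))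

theorem hasDerivAt_y {f : ℝ × ℝ × ℝ × ℝ → ℝ} (hf : Differentiable ℝ f) (x y z t : ℝ) :
    HasDerivAt (fun s => f (x, s, z, t)) (pY f (x, y, z, t)) y :=
  (hf (x, y, z, t)).hasFDerivAt.comp_hasDerivAt y
    ((hasDerivAt_const y x).prodMk ((hasDerivAt_id y).prodMk
      ((hasDerivAt_const y z).prodMk (hasDerivAt_const y t))))

theorem hasDerivAt_z {f : ℝ × ℝ × ℝ × ℝ → ℝ} (hf : Differentiable ℝ f) (x y z t : ℝ) :
    HasDerivAt (fun s => f (x, y, s, t)) (pZ f (x, y, z, t)) z :=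
  (hf (x, y, z, t)).hasFDerivAt.comp_hasDerivAt z
    ((hasDerivAt_const z x).prodMk ((hasDerivAt_const z y).prodMk
      ((hasDerivAt_id z).prodMk (hasDerivAt_const z t))))

theorem eq_of_hasDerivAt_zero_s9 {f f' : ℝ → ℝ} (hf : ∀ s, HasDerivAt f (f' s) s)
    (hf' : ∀ s, f' s = 0) (a b : ℝ) : f a = f b :=
  is_const_of_deriv_eq_zero (fun s => (hf s).differentiableAt)
    (fun s => (hf s).deriv.trans (hf' s)) a b

/-- The flow at time `τ` of the vector field `Λ₁ ∂x + A ∂y + (Λ₃ + β y) ∂z`. -/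
noncomputable def charFlow (Λ₁ A Λ₃ β τ : ℝ) (p : ℝ × ℝ × ℝ × ℝ) : ℝ × ℝ × ℝ × ℝ :=
  (p.1 + Λ₁ * τ, p.2.1 + A * τ, p.2.2.1 + (Λ₃ + β * p.2.1) * τ + β * A * τ ^ 2 / 2, p.2.2.2)

section Transport

variable {Λ₁ A Λ₃ β : ℝ} {f : ℝ × ℝ × ℝ × ℝ → ℝ}

theorem apply_charFlow (hf : Differentiable ℝ f)
    (hD : ∀ p, Λ₁ * pX f p + A * pY f p + (Λ₃ + β * p.2.1) * pZ f p = 0)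
    (τ : ℝ) (p : ℝ × ℝ × ℝ × ℝ) : f (charFlow Λ₁ A Λ₃ β τ p) = f p := by
  obtain ⟨x, y, z, t⟩ := p
  have hγ : ∀ s, HasDerivAt (fun s => charFlow Λ₁ A Λ₃ β s (x, y, z, t))
      (Λ₁, A, Λ₃ + β * (y + A * s), 0) s := by
    intro s
    have h1 : HasDerivAt (fun s : ℝ => x + Λ₁ * s) Λ₁ s := by
      simpa using ((hasDerivAt_id s).const_mul Λ₁).const_add x
    have h2 : HasDerivAt (fun s : ℝ => y + A * s) A s := by
      simpa using ((hasDerivAt_id s).const_mul A).const_add y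
    have h3 : HasDerivAt (fun s : ℝ => z + (Λ₃ + β * y) * s + β * A * s ^ 2 / 2)
        (Λ₃ + β * (y + A * s)) s :=
      ((((hasDerivAt_id s).const_mul (Λ₃ + β * y)).const_add z).add
        (((hasDerivAt_pow 2 s).const_mul (β * A)).div_const 2)).congr_deriv (by push_cast; ring)
    exact h1.prodMk (h2.prodMk (h3.prodMk (hasDerivAt_const s t)))
  have := eq_of_hasDerivAt_zero_s9
    (fun s => (hf (charFlow Λ₁ A Λ₃ β s (x, y, z, t))).hasFDerivAt.comp_hasDerivAt s (hγ s))
    (fun s => by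
      rw [fderiv_apply_eq]
      have := hD (charFlow Λ₁ A Λ₃ β s (x, y, z, t))
      rw [charFlow] at this ⊢
      linear_combination this) τ 0
  simpa [charFlow] using this

theorem fderiv_charFlow (hf : Differentiable ℝ f) {τ : ℝ}
    (hinv : ∀ p, f (charFlow Λ₁ A Λ₃ β τ p) = f p) (a c : ℝ) (p : ℝ × ℝ × ℝ × ℝ) :
    fderiv ℝ f (charFlow Λ₁ A Λ₃ β τ p) (a, 0, c, 0) = fderiv ℝ f p (a, 0, c, 0) := by
  refine HasDerivAt.unique
    ((hf (charFlow Λ₁ A Λ₃ β τ p)).hasFDerivAt.hasLineDerivAt (a, 0, c, 0)) ?_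
  have h : HasDerivAt _ _ _ := (hf p).hasFDerivAt.hasLineDerivAt (a, 0, c, 0)
  convert h using 2 with s
  rw [← hinv (p + s • (a, 0, c, 0))]
  congr 1
  ext <;> simp [charFlow] <;> ring

theorem fderiv_transport (hf : ContDiff ℝ 2 f)
    (hD : ∀ p, Λ₁ * pX f p + A * pY f p + (Λ₃ + β * p.2.1) * pZ f p = 0)
    (p e : ℝ × ℝ × ℝ × ℝ) :
    Λ₁ * fderiv ℝ (pX f) p e + A * fderiv ℝ (pY f) p e
      + ((Λ₃ + β * p.2.1) * fderiv ℝ (pZ f) p e + pZ f p * (β * e.2.1)) = 0 := by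
  have hd := fun e' => (hf.differentiable_fderiv_dir e' p).hasFDerivAt
  have hL := (((hd (1, 0, 0, 0)).const_mul Λ₁).add ((hd (0, 1, 0, 0)).const_mul A)).add
    ((((hasFDerivAt_coord_y p).const_mul β).const_add Λ₃).mul (hd (0, 0, 1, 0)))
  exact congrArg (fun L => L e) (hL.unique ((hasFDerivAt_const (0 : ℝ) p).congr_of_eventuallyEq
    (Filter.Eventually.of_forall hD)))

/-- A function that is harmonic in `(x, y, z)` and transported by
`Λ₁ ∂x + A ∂y + (Λ₃ + β y) ∂z` is affine in `z`. -/
theorem pZ_pZ_eq_zero (hA : A ≠ 0) (hβ : β ≠ 0) (hf : ContDiff ℝ 2 f)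
    (hD : ∀ p, Λ₁ * pX f p + A * pY f p + (Λ₃ + β * p.2.1) * pZ f p = 0)
    (hΔ : ∀ p, pX (pX f) p + pY (pY f) p + pZ (pZ f) p = 0) (p : ℝ × ℝ × ℝ × ℝ) :
    pZ (pZ f) p = 0 := by
  have hdf := hf.differentiable two_ne_zero
  have key : ∀ q, (A ^ 2 + Λ₁ ^ 2) * pX (pX f) q + 2 * Λ₁ * (Λ₃ + β * q.2.1) * pX (pZ f) q
      + (A ^ 2 + (Λ₃ + β * q.2.1) ^ 2) * pZ (pZ f) q - β * A * pZ f q = 0 := by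
    intro q
    have ex : Λ₁ * pX (pX f) q + A * pX (pY f) q
      + ((Λ₃ + β * q.2.1) * pX (pZ f) q + pZ f q * (β * 0)) = 0 := fderiv_transport hf hD q _
    have ey : Λ₁ * pY (pX f) q + A * pY (pY f) q
      + ((Λ₃ + β * q.2.1) * pY (pZ f) q + pZ f q * (β * 1)) = 0 := fderiv_transport hf hD q _
    have ez : Λ₁ * pZ (pX f) q + A * pZ (pY f) q
      + ((Λ₃ + β * q.2.1) * pZ (pZ f) q + pZ f q * (β * 0)) = 0 := fderiv_transport hf hD q _
    have cxy : pX (pY f) q = pY (pX f) q := hf.fderiv_dir_comm q _ _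
    have cxz : pX (pZ f) q = pZ (pX f) q := hf.fderiv_dir_comm q _ _
    have cyz : pY (pZ f) q = pZ (pY f) q := hf.fderiv_dir_comm q _ _
    rw [cxy, cxz] at ex
    rw [cyz] at ey
    rw [cxz]
    linear_combination A ^ 2 * hΔ q + Λ₁ * ex - A * ey + (Λ₃ + β * q.2.1) * ez
  have hz : ∀ τ q, pZ f (charFlow Λ₁ A Λ₃ β τ q) = pZ f q := fun τ =>
    fderiv_charFlow hdf (apply_charFlow hdf hD τ) 0 1
  have hx : ∀ τ q, pX f (charFlow Λ₁ A Λ₃ β τ q) = pX f q := fun τ =>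
    fderiv_charFlow hdf (apply_charFlow hdf hD τ) 1 0
  have hzz : ∀ τ q, pZ (pZ f) (charFlow Λ₁ A Λ₃ β τ q) = pZ (pZ f) q := fun τ =>
    fderiv_charFlow (hf.differentiable_fderiv_dir _) (hz τ) 0 1
  have hxz : ∀ τ q, pX (pZ f) (charFlow Λ₁ A Λ₃ β τ q) = pX (pZ f) q := fun τ =>
    fderiv_charFlow (hf.differentiable_fderiv_dir _) (hz τ) 1 0
  have hxx : ∀ τ q, pX (pX f) (charFlow Λ₁ A Λ₃ β τ q) = pX (pX f) q := fun τ =>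
    fderiv_charFlow (hf.differentiable_fderiv_dir _) (hx τ) 1 0
  have k0 := key p
  have k1 := key (charFlow Λ₁ A Λ₃ β 1 p)
  have k2 := key (charFlow Λ₁ A Λ₃ β (-1) p)
  rw [hz, hzz, hxz, hxx] at k1 k2
  simp only [charFlow] at k1 k2
  have : 2 * (β * A) ^ 2 * pZ (pZ f) p = 0 := by linear_combination k1 + k2 - 2 * k0
  simpa [hA, hβ] using this

end Transport

namespace IsBetaPlaneFlow

variable {Ω β ρ Λ₁ Λ₂ Λ₃ : ℝ} {u v w P : ℝ × ℝ × ℝ × ℝ → ℝ}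

theorem laplacian_u (h : IsBetaPlaneFlow Ω β ρ Λ₁ Λ₂ Λ₃ u v w P) (p : ℝ × ℝ × ℝ × ℝ) :
    pX (pX u) p + pY (pY u) p + pZ (pZ u) p = 0 := by
  have m : pX (pX u) p + pX (pY v) p + pX (pZ w) p = 0 := h.fderiv_mass p _
  have c1 : pX (pY v) p = pY (pX v) p := h.contDiff_v.fderiv_dir_comm p _ _
  have c2 : pX (pZ w) p = pZ (pX w) p := h.contDiff_w.fderiv_dir_comm p _ _
  have e1 : pY (pX v) p = pY (pY u) p := DFunLike.congr_fun (h.fderiv_vort_z p) _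
  have e2 : pZ (pZ u) p = pZ (pX w) p := DFunLike.congr_fun (h.fderiv_vort_y p) _
  rw [e2, ← c2, ← e1, ← c1, m]

theorem laplacian_v (h : IsBetaPlaneFlow Ω β ρ Λ₁ Λ₂ Λ₃ u v w P) (p : ℝ × ℝ × ℝ × ℝ) :
    pX (pX v) p + pY (pY v) p + pZ (pZ v) p = 0 := by
  have m : pY (pX u) p + pY (pY v) p + pY (pZ w) p = 0 := h.fderiv_mass p _
  have c1 : pX (pY u) p = pY (pX u) p := h.contDiff_u.fderiv_dir_comm p _ _
  have c2 : pY (pZ w) p = pZ (pY w) p := h.contDiff_w.fderiv_dir_comm p _ _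
  have e1 : pX (pX v) p = pX (pY u) p := DFunLike.congr_fun (h.fderiv_vort_z p) _
  have e2 : pZ (pY w) p = pZ (pZ v) p := DFunLike.congr_fun (h.fderiv_vort_x p) _
  rw [e1, c1, ← e2, ← c2, m]

theorem pZ_w_eq (h : IsBetaPlaneFlow Ω β ρ Λ₁ Λ₂ Λ₃ u v w P) (hβ : β ≠ 0)
    (hΩ : Λ₂ + 2 * Ω ≠ 0) (x y z t : ℝ) : pZ w (x, y, z, t) = pZ w (0, 0, z, t) := by
  have uzz := pZ_pZ_eq_zero hΩ hβ h.contDiff_u (fun p => (h.vorticity_equations p).1)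
    h.laplacian_u
  have vzz := pZ_pZ_eq_zero hΩ hβ h.contDiff_v (fun p => (h.vorticity_equations p).2.1)
    h.laplacian_v
  have dwz : Differentiable ℝ (pZ w) := h.contDiff_w.differentiable_fderiv_dir _
  have wxz : ∀ p, pX (pZ w) p = 0 := fun p => by
    have c : pX (pZ w) p = pZ (pX w) p := h.contDiff_w.fderiv_dir_comm p _ _
    have e : pZ (pZ u) p = pZ (pX w) p := DFunLike.congr_fun (h.fderiv_vort_y p) _
    rw [c, ← e, uzz]
  have wyz : ∀ p, pY (pZ w) p = 0 := fun p => by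
    have c : pY (pZ w) p = pZ (pY w) p := h.contDiff_w.fderiv_dir_comm p _ _
    have e : pZ (pY w) p = pZ (pZ v) p := DFunLike.congr_fun (h.fderiv_vort_x p) _
    rw [c, e, vzz]
  exact (eq_of_hasDerivAt_zero_s9 (fun s => hasDerivAt_x dwz s y z t) (fun s => wxz _) x 0).trans
    (eq_of_hasDerivAt_zero_s9 (fun s => hasDerivAt_y dwz 0 s z t) (fun s => wyz _) y 0)

/-- On a horizontal plane that is not crossed by the flow, the gradient of the velocity and its
meridional component vanish. -/
theorem eq_zero_on_plane (h : IsBetaPlaneFlow Ω β ρ Λ₁ Λ₂ Λ₃ u v w P) (hβ : β ≠ 0)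
    (hΩ : Λ₂ + 2 * Ω ≠ 0) {z₀ : ℝ} (hw : ∀ x y t, w (x, y, z₀, t) = 0) (x y t : ℝ) :
    v (x, y, z₀, t) = 0 ∧ pX u (x, y, z₀, t) = 0 ∧ pY u (x, y, z₀, t) = 0 ∧
      pZ u (x, y, z₀, t) = 0 ∧ pZ v (x, y, z₀, t) = 0 := by
  have dv := h.contDiff_v.differentiable two_ne_zero
  have dw := h.contDiff_w.differentiable two_ne_zero
  have wx : ∀ x y, pX w (x, y, z₀, t) = 0 := fun x y => by
    have := hasDerivAt_x dw x y z₀ t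
    simp only [hw] at this
    exact this.unique (hasDerivAt_const x 0)
  have wy : ∀ x y, pY w (x, y, z₀, t) = 0 := fun x y => by
    have := hasDerivAt_y dw x y z₀ t
    simp only [hw] at this
    exact this.unique (hasDerivAt_const y 0)
  set c := pZ w (0, 0, z₀, t)
  have wz : ∀ x y, pZ w (x, y, z₀, t) = c := fun x y => h.pZ_w_eq hβ hΩ x y z₀ t
  have hv : ∀ x y, v (x, y, z₀, t) = (Λ₃ + β * y) * c / β := fun x y => by
    have := (h.vorticity_equations (x, y, z₀, t)).2.2
    rw [wx, wy, wz] at this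
    rw [eq_div_iff hβ]
    linear_combination -this
  have vx : ∀ x y, pX v (x, y, z₀, t) = 0 := fun x y => by
    have := hasDerivAt_x dv x y z₀ t
    simp only [hv] at this
    exact this.unique (hasDerivAt_const x _)
  have vy : ∀ x y, pY v (x, y, z₀, t) = c := fun x y => by
    have := hasDerivAt_y dv x y z₀ t
    simp only [hv] at this
    exact this.unique (((((hasDerivAt_id y).const_mul β).const_add Λ₃).mul_const c).div_const β
      |>.congr_deriv (by field_simp))
  have vz : ∀ x y, pZ v (x, y, z₀, t) = -Λ₁ := fun x y => by
    linear_combination wy x y - h.vort_x (x, y, z₀, t)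
  have hvD : ∀ y, (Λ₂ + 2 * Ω) * c - (Λ₃ + β * y) * Λ₁ = 0 := fun y => by
    have := (h.vorticity_equations (0, y, z₀, t)).2.1
    rw [vx, vy, vz] at this
    linear_combination this
  have hY0 : Λ₃ + β * (-Λ₃ / β) = 0 := by field_simp; ring
  have hY1 : Λ₃ + β * ((1 - Λ₃) / β) = 1 := by field_simp; ring
  have hc0 : c = 0 := by
    have := hvD (-Λ₃ / β)
    rw [hY0] at this
    simpa [hΩ] using this
  have hΛ₁ : Λ₁ = 0 := by
    have := hvD ((1 - Λ₃) / β)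
    rw [hY1, hc0] at this
    linear_combination -this
  have uy : ∀ x y, pY u (x, y, z₀, t) = -Λ₃ := fun x y => by
    linear_combination vx x y - h.vort_z (x, y, z₀, t)
  have uz : ∀ x y, pZ u (x, y, z₀, t) = Λ₂ := fun x y => by
    linear_combination wx x y + h.vort_y (x, y, z₀, t)
  have huD : ∀ y, -(Λ₂ + 2 * Ω) * Λ₃ + (Λ₃ + β * y) * Λ₂ = 0 := fun y => by
    have := (h.vorticity_equations (0, y, z₀, t)).1
    rw [uy, uz, hΛ₁] at this
    linear_combination this
  have hΛ₃ : Λ₃ = 0 := by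
    have := huD (-Λ₃ / β)
    rw [hY0, zero_mul, add_zero] at this
    exact (mul_eq_zero.mp this).resolve_left (neg_ne_zero.mpr hΩ)
  have hΛ₂ : Λ₂ = 0 := by
    have := huD ((1 - Λ₃) / β)
    rw [hY1] at this
    linear_combination this + (Λ₂ + 2 * Ω) * hΛ₃
  refine ⟨by rw [hv, hc0]; simp, ?_, by rw [uy, hΛ₃, neg_zero], by rw [uz, hΛ₂],
    by rw [vz, hΛ₁, neg_zero]⟩
  linear_combination h.mass (x, y, z₀, t) - vy x y - wz x y - 2 * hc0

/-- A flow that does not cross some horizontal plane is zonal, with spatially constant velocity. -/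
theorem eq_zonal (h : IsBetaPlaneFlow Ω β ρ Λ₁ Λ₂ Λ₃ u v w P) (hβ : β ≠ 0)
    (hΩ : Λ₂ + 2 * Ω ≠ 0) {z₀ : ℝ} (hw : ∀ x y t, w (x, y, z₀, t) = 0) :
    v = 0 ∧ w = 0 ∧ ∀ x y z t, u (x, y, z, t) = u (0, 0, 0, t) := by
  have du := h.contDiff_u.differentiable two_ne_zero
  have dv := h.contDiff_v.differentiable two_ne_zero
  have dw := h.contDiff_w.differentiable two_ne_zero
  have duz : Differentiable ℝ (pZ u) := h.contDiff_u.differentiable_fderiv_dir _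
  have dvz : Differentiable ℝ (pZ v) := h.contDiff_v.differentiable_fderiv_dir _
  have h0 := h.eq_zero_on_plane hβ hΩ hw
  have uzz := pZ_pZ_eq_zero hΩ hβ h.contDiff_u (fun p => (h.vorticity_equations p).1)
    h.laplacian_u
  have vzz := pZ_pZ_eq_zero hΩ hβ h.contDiff_v (fun p => (h.vorticity_equations p).2.1)
    h.laplacian_v
  have uz : ∀ x y z t, pZ u (x, y, z, t) = 0 := fun x y z t =>
    (eq_of_hasDerivAt_zero_s9 (fun s => hasDerivAt_z duz x y s t) (fun s => uzz _) z z₀).trans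
      (h0 x y t).2.2.2.1
  have vz : ∀ x y z t, pZ v (x, y, z, t) = 0 := fun x y z t =>
    (eq_of_hasDerivAt_zero_s9 (fun s => hasDerivAt_z dvz x y s t) (fun s => vzz _) z z₀).trans
      (h0 x y t).2.2.2.2
  have hu : ∀ x y z z' t, u (x, y, z, t) = u (x, y, z', t) := fun x y z z' t =>
    eq_of_hasDerivAt_zero_s9 (fun s => hasDerivAt_z du x y s t) (fun s => uz x y s t) z z'
  have hv : v = 0 := funext fun ⟨x, y, z, t⟩ =>
    (eq_of_hasDerivAt_zero_s9 (fun s => hasDerivAt_z dv x y s t) (fun s => vz x y s t) z z₀).trans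
      (h0 x y t).1
  have ux : ∀ x y z t, pX u (x, y, z, t) = 0 := fun x y z t => by
    have h1 := hasDerivAt_x du x y z t
    simp only [hu _ _ z z₀] at h1
    exact (h1.unique (hasDerivAt_x du x y z₀ t)).trans (h0 x y t).2.1
  have uy : ∀ x y z t, pY u (x, y, z, t) = 0 := fun x y z t => by
    have h1 := hasDerivAt_y du x y z t
    simp only [hu _ _ z z₀] at h1
    exact (h1.unique (hasDerivAt_y du x y z₀ t)).trans (h0 x y t).2.2.1
  have wz : ∀ x y z t, pZ w (x, y, z, t) = 0 := fun x y z t => by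
    have m := h.mass (x, y, z, t)
    have vy : pY v (x, y, z, t) = 0 := by simp [hv, pY]
    linear_combination m - ux x y z t - vy
  refine ⟨hv, funext fun ⟨x, y, z, t⟩ =>
    (eq_of_hasDerivAt_zero_s9 (fun s => hasDerivAt_z dw x y s t) (fun s => wz x y s t) z z₀).trans
      (hw x y t), fun x y z t => ?_⟩
  rw [hu x y z 0,
    eq_of_hasDerivAt_zero_s9 (fun s => hasDerivAt_x du s y 0 t) (fun s => ux s y 0 t) x 0]
  exact eq_of_hasDerivAt_zero_s9 (fun s => hasDerivAt_y du 0 s 0 t) (fun s => uy 0 s 0 t) y 0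

end IsBetaPlaneFlow

theorem eq_zero_of_abs_linear_add_le {a b M N : ℝ} {η : ℝ → ℝ} (hη : ∀ y, |η y| ≤ N)
    (h : ∀ y, |a * y + b * η y| ≤ M) : a = 0 := by
  by_contra ha
  have hb : ∀ y, |a * y| ≤ M + |b| * N := fun y => by
    calc |a * y| = |(a * y + b * η y) - b * η y| := by ring_nf
      _ ≤ |a * y + b * η y| + |b * η y| := abs_sub _ _
      _ ≤ M + |b| * N := by
        rw [abs_mul b]
        exact add_le_add (h y) (mul_le_mul_of_nonneg_left (hη y) (abs_nonneg b))
  have := hb ((M + |b| * N + 1) / a)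
  rw [mul_div_cancel₀ _ ha] at this
  linarith [le_abs_self (M + |b| * N + 1)]

/-- The pressure in a layer is hydrostatic, with effective gravity `2Ω³/β − Ω²R + g`. -/
theorem IsBetaPlaneFlow.pressure_eq {Ω R g β ρ Λ₁ Λ₂ Λ₃ z₀ : ℝ}
    {u v w Ptil P : ℝ × ℝ × ℝ × ℝ → ℝ}
    (h : IsBetaPlaneFlow Ω β ρ Λ₁ Λ₂ Λ₃ u v w Ptil) (hβ : β ≠ 0) (hρ : ρ ≠ 0)
    (hΩ : Λ₂ + 2 * Ω ≠ 0) (hw : ∀ x y t, w (x, y, z₀, t) = 0)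
    (hP : ∀ p, P p = Ptil p + ρ * Ω ^ 2 * p.2.1 ^ 2 / 2 - ρ * (Ω ^ 2 * R - g) * p.2.2.1)
    {η : ℝ × ℝ × ℝ → ℝ} (hη : ∃ M : ℝ, ∀ q, |sY η q| ≤ M)
    (hbound : ∀ x t, ∃ M : ℝ, ∀ y, |pY P (x, y, η (x, y, t), t)
      + pZ P (x, y, η (x, y, t), t) * sY η (x, y, t)| ≤ M) (x y z t : ℝ) :
    P (x, y, z, t) = P (0, 0, 0, t) + ρ * (2 * Ω ^ 3 / β - Ω ^ 2 * R + g) * z := by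
  obtain ⟨hv, hw0, hu⟩ := h.eq_zonal hβ hΩ hw
  have dPt := h.contDiff_P.differentiable two_ne_zero
  have dP : Differentiable ℝ P := by
    rw [funext hP]
    fun_prop
  have Py : ∀ x y z t, pY P (x, y, z, t) = ρ * (Ω ^ 2 - β * u (0, 0, 0, t)) * y := by
    intro x y z t
    have h1 := hasDerivAt_y dP x y z t
    simp only [hP] at h1
    have h2 := ((hasDerivAt_y dPt x y z t).add
      (((hasDerivAt_pow 2 y).const_mul (ρ * Ω ^ 2)).div_const 2)).sub_const
        (ρ * (Ω ^ 2 * R - g) * z)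
    have h3 := h.momentum_y (x, y, z, t)
    rw [hu x y z t, eq_div_iff hρ] at h3
    simp [hv, hw0, pX, pY, pZ, pT] at h3
    rw [h1.unique h2]
    simp [pY]
    linear_combination h3
  have Pz : ∀ x y z t, pZ P (x, y, z, t) = ρ * (2 * Ω * u (0, 0, 0, t) - Ω ^ 2 * R + g) := by
    intro x y z t
    have h1 := hasDerivAt_z dP x y z t
    simp only [hP] at h1
    have h2 := ((hasDerivAt_z dPt x y z t).add_const (ρ * Ω ^ 2 * y ^ 2 / 2)).sub
      ((hasDerivAt_id z).const_mul (ρ * (Ω ^ 2 * R - g)))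
    have h3 := h.momentum_z (x, y, z, t)
    rw [hu x y z t, eq_div_iff hρ] at h3
    simp [hv, hw0, pX, pY, pZ, pT] at h3
    rw [h1.unique h2]
    simp [pZ]
    linear_combination -h3
  have hU : ∀ t, u (0, 0, 0, t) = Ω ^ 2 / β := by
    intro t
    obtain ⟨N, hN⟩ := hη
    obtain ⟨M, hM⟩ := hbound 0 t
    simp only [Py, Pz] at hM
    have := eq_zero_of_abs_linear_add_le (fun y => hN (0, y, t)) hM
    rw [eq_div_iff hβ]
    linear_combination -(mul_eq_zero.mp this).resolve_left hρ
  have Px : ∀ x y z t, pX P (x, y, z, t) = 0 := by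
    intro x y z t
    have hu' : u = fun _ => Ω ^ 2 / β := funext fun ⟨x, y, z, t⟩ => by rw [hu, hU]
    have h1 := hasDerivAt_x dP x y z t
    simp only [hP] at h1
    have h2 := ((hasDerivAt_x dPt x y z t).add_const (ρ * Ω ^ 2 * y ^ 2 / 2)).sub_const
      (ρ * (Ω ^ 2 * R - g) * z)
    have h3 := h.momentum_x (x, y, z, t)
    rw [eq_div_iff hρ] at h3
    simp [hv, hw0, hu', pX, pY, pZ, pT] at h3
    exact (h1.unique h2).trans h3
  have e1 := eq_of_hasDerivAt_zero_s9 (fun s => hasDerivAt_x dP s y z t)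
    (fun s => Px s y z t) x 0
  have e2 := eq_of_hasDerivAt_zero_s9 (fun s => hasDerivAt_y dP 0 s z t)
    (fun s => by rw [Py, hU]; field_simp; ring) y 0
  have e3 := eq_of_hasDerivAt_zero_s9
    (fun s => (hasDerivAt_z dP 0 0 s t).sub
      ((hasDerivAt_id s).const_mul (ρ * (2 * Ω ^ 3 / β - Ω ^ 2 * R + g))))
    (fun s => by rw [Pz, hU]; field_simp; ring) z 0
  simp at e3
  linear_combination e1 + e2 + e3

/-- Theorem 2 (two-layer flow): with pressure continuity at the interface `z = η₁` and
atmospheric pressure on the free surface `z = η₂`, the layer pressures are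
`P₂ = ρ₂k(z − η₂) + P_atm` and `P₁ = ρ₁kz + (ρ₂ − ρ₁)kη₁ − ρ₂kη₂ + P_atm`,
where `k = 2Ω³/β − Ω²R + g`. -/
theorem theorem2_two_layer (Ω R g d z₀ Patm β ρ₁ ρ₂ : ℝ)
    (hβ : 0 < β) (hρ₁ : 0 < ρ₁) (hρ₂ : 0 < ρ₂)
    (k : ℝ) (hk : k = 2 * Ω ^ 3 / β - Ω ^ 2 * R + g)
    (Λ₁₁ Λ₂₁ Λ₃₁ Λ₁₂ Λ₂₂ Λ₃₂ : ℝ)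
    (hΩ₁ : Λ₂₁ + 2 * Ω ≠ 0) (hΩ₂ : Λ₂₂ + 2 * Ω ≠ 0)
    (u₁ v₁ w₁ Ptil₁ P₁ u₂ v₂ w₂ Ptil₂ P₂ : ℝ × ℝ × ℝ × ℝ → ℝ)
    (hu₁ : ContDiff ℝ 2 u₁) (hv₁ : ContDiff ℝ 2 v₁) (hw₁ : ContDiff ℝ 2 w₁)
    (hPtil₁ : ContDiff ℝ 2 Ptil₁)
    (hu₂ : ContDiff ℝ 2 u₂) (hv₂ : ContDiff ℝ 2 v₂) (hw₂ : ContDiff ℝ 2 w₂)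
    (hPtil₂ : ContDiff ℝ 2 Ptil₂)
    -- transformed β-plane system in the lower layer
    (heq1₁ : ∀ p : ℝ × ℝ × ℝ × ℝ,
      pT u₁ p + u₁ p * pX u₁ p + v₁ p * pY u₁ p + w₁ p * pZ u₁ p + 2 * Ω * w₁ p
        - β * p.2.1 * v₁ p = -(pX Ptil₁ p) / ρ₁)
    (heq2₁ : ∀ p : ℝ × ℝ × ℝ × ℝ,
      pT v₁ p + u₁ p * pX v₁ p + v₁ p * pY v₁ p + w₁ p * pZ v₁ p + β * p.2.1 * u₁ p
        = -(pY Ptil₁ p) / ρ₁)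
    (heq3₁ : ∀ p : ℝ × ℝ × ℝ × ℝ,
      pT w₁ p + u₁ p * pX w₁ p + v₁ p * pY w₁ p + w₁ p * pZ w₁ p - 2 * Ω * u₁ p
        = -(pZ Ptil₁ p) / ρ₁)
    -- transformed β-plane system in the upper layer
    (heq1₂ : ∀ p : ℝ × ℝ × ℝ × ℝ,
      pT u₂ p + u₂ p * pX u₂ p + v₂ p * pY u₂ p + w₂ p * pZ u₂ p + 2 * Ω * w₂ p
        - β * p.2.1 * v₂ p = -(pX Ptil₂ p) / ρ₂)
    (heq2₂ : ∀ p : ℝ × ℝ × ℝ × ℝ,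
      pT v₂ p + u₂ p * pX v₂ p + v₂ p * pY v₂ p + w₂ p * pZ v₂ p + β * p.2.1 * u₂ p
        = -(pY Ptil₂ p) / ρ₂)
    (heq3₂ : ∀ p : ℝ × ℝ × ℝ × ℝ,
      pT w₂ p + u₂ p * pX w₂ p + v₂ p * pY w₂ p + w₂ p * pZ w₂ p - 2 * Ω * u₂ p
        = -(pZ Ptil₂ p) / ρ₂)
    -- mass conservation
    (hmass₁ : ∀ p : ℝ × ℝ × ℝ × ℝ, pX u₁ p + pY v₁ p + pZ w₁ p = 0)
    (hmass₂ : ∀ p : ℝ × ℝ × ℝ × ℝ, pX u₂ p + pY v₂ p + pZ w₂ p = 0)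
    -- constant vorticity in each layer
    (hvort1₁ : ∀ p : ℝ × ℝ × ℝ × ℝ, pY w₁ p - pZ v₁ p = Λ₁₁)
    (hvort2₁ : ∀ p : ℝ × ℝ × ℝ × ℝ, pZ u₁ p - pX w₁ p = Λ₂₁)
    (hvort3₁ : ∀ p : ℝ × ℝ × ℝ × ℝ, pX v₁ p - pY u₁ p = Λ₃₁)
    (hvort1₂ : ∀ p : ℝ × ℝ × ℝ × ℝ, pY w₂ p - pZ v₂ p = Λ₁₂)
    (hvort2₂ : ∀ p : ℝ × ℝ × ℝ × ℝ, pZ u₂ p - pX w₂ p = Λ₂₂)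
    (hvort3₂ : ∀ p : ℝ × ℝ × ℝ × ℝ, pX v₂ p - pY u₂ p = Λ₃₂)
    -- flat boundary conditions
    (hbot₁ : ∀ x y t : ℝ, w₁ (x, y, -d, t) = 0)
    (hbot₂ : ∀ x y t : ℝ, w₂ (x, y, z₀, t) = 0)
    -- the physical pressures
    (hPdef₁ : ∀ p : ℝ × ℝ × ℝ × ℝ,
      P₁ p = Ptil₁ p + ρ₁ * Ω ^ 2 * p.2.1 ^ 2 / 2 - ρ₁ * (Ω ^ 2 * R - g) * p.2.2.1)
    (hPdef₂ : ∀ p : ℝ × ℝ × ℝ × ℝ,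
      P₂ p = Ptil₂ p + ρ₂ * Ω ^ 2 * p.2.1 ^ 2 / 2 - ρ₂ * (Ω ^ 2 * R - g) * p.2.2.1)
    -- the interface and the free surface
    (η₁ η₂ : ℝ × ℝ × ℝ → ℝ) (hη₁ : Differentiable ℝ η₁) (hη₂ : Differentiable ℝ η₂)
    (hη₁y : ∃ M : ℝ, ∀ q : ℝ × ℝ × ℝ, |sY η₁ q| ≤ M)
    (hη₂y : ∃ M : ℝ, ∀ q : ℝ × ℝ × ℝ, |sY η₂ q| ≤ M)
    (hbound₁ : ∀ x t : ℝ, ∃ M : ℝ, ∀ y : ℝ,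
      |pY P₁ (x, y, η₁ (x, y, t), t)
        + pZ P₁ (x, y, η₁ (x, y, t), t) * sY η₁ (x, y, t)| ≤ M)
    (hbound₂ : ∀ x t : ℝ, ∃ M : ℝ, ∀ y : ℝ,
      |pY P₂ (x, y, η₂ (x, y, t), t)
        + pZ P₂ (x, y, η₂ (x, y, t), t) * sY η₂ (x, y, t)| ≤ M)
    -- pressure continuity at the interface and atmospheric pressure at the free surface
    (hinterface : ∀ x y t : ℝ,
      P₁ (x, y, η₁ (x, y, t), t) = P₂ (x, y, η₁ (x, y, t), t))
    (hsurface : ∀ x y t : ℝ, P₂ (x, y, η₂ (x, y, t), t) = Patm) :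
    (∀ x y z t : ℝ, P₂ (x, y, z, t) = ρ₂ * k * (z - η₂ (x, y, t)) + Patm) ∧
    (∀ x y z t : ℝ, P₁ (x, y, z, t)
      = ρ₁ * k * z + (ρ₂ - ρ₁) * k * η₁ (x, y, t) - ρ₂ * k * η₂ (x, y, t) + Patm) := by
  subst hk
  have h₁ : IsBetaPlaneFlow Ω β ρ₁ Λ₁₁ Λ₂₁ Λ₃₁ u₁ v₁ w₁ Ptil₁ :=
    ⟨hu₁, hv₁, hw₁, hPtil₁, heq1₁, heq2₁, heq3₁, hmass₁, hvort1₁, hvort2₁, hvort3₁⟩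
  have h₂ : IsBetaPlaneFlow Ω β ρ₂ Λ₁₂ Λ₂₂ Λ₃₂ u₂ v₂ w₂ Ptil₂ :=
    ⟨hu₂, hv₂, hw₂, hPtil₂, heq1₂, heq2₂, heq3₂, hmass₂, hvort1₂, hvort2₂, hvort3₂⟩
  have e₁ := h₁.pressure_eq hβ.ne' hρ₁.ne' hΩ₁ hbot₁ hPdef₁ hη₁y hbound₁
  have e₂ := h₂.pressure_eq hβ.ne' hρ₂.ne' hΩ₂ hbot₂ hPdef₂ hη₂y hbound₂
  refine ⟨fun x y z t => ?_, fun x y z t => ?_⟩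
  · linear_combination e₂ x y z t - e₂ x y (η₂ (x, y, t)) t + hsurface x y t
  · linear_combination e₁ x y z t - e₁ x y (η₁ (x, y, t)) t + hinterface x y t
      + e₂ x y (η₁ (x, y, t)) t - e₂ x y (η₂ (x, y, t)) t + hsurface x y t
end
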